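/- arXiv:1708.01317 — 2 statements merged into one kernel-verified Lean document; each statement's English description precedes it below -/
import Mathlib

section
/- For every pair of finite metric spaces M, N, every r ∈ ℕ, and every ε > 0, there exists a finite metric space P such that every r-coloring of the set emb(M,P) of isometric embeddings of M into P admits σ ∈ emb(N,P) such that σ ∘ emb(M,N) is ε-monochromatic (i.e., contained in the ε-neighborhood of a single color class, with respect to the sup metric d(σ,τ) = max_{x∈M} d_P(σ(x),τ(x))). -/
/-- `f : M → P` is an isometric embedding of metric spaces. -/
def IsIsomEmb {M P : Type} [MetricSpace M] [MetricSpace P] (f : M → P) : Prop :=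
  ∀ x y : M, dist (f x) (f y) = dist x y

/-- The total weight of the walk that leads from `a` to `b` through the vertices of a list. -/
def walkCost {B : Type} (w : B → B → NNReal) : B → List B → B → NNReal
  | a, [], b => w a b
  | a, x :: l, b => w a x + walkCost w x l b

/-- `w` is a weight on `B`, with values in `[δ, D]` off the diagonal, which extends the metric of
`N` along `e`, and any two isometric copies of `M` in `N` are exchanged by a symmetry of `w`.
The weight `D` marks pairs whose distance is not prescribed. -/
structure IsExtensionWitness (M N : Type) [MetricSpace M] [MetricSpace N] (δ D : NNReal)
    {B : Type} (w : B → B → NNReal) (e : N → B) : Prop where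
  self : ∀ a, w a a = 0
  comm : ∀ a b, w a b = w b a
  le_of_ne : ∀ a b, a ≠ b → δ ≤ w a b
  le : ∀ a b, w a b ≤ D
  map_eq : ∀ x y, w (e x) (e y) = nndist x y
  extend : ∀ τ τ' : M → N, IsIsomEmb τ → IsIsomEmb τ' →
    ∃ g : Equiv.Perm B, (∀ a b, w (g a) (g b) = w a b) ∧ ∀ m, g (e (τ m)) = e (τ' m)

/-- No walk with at most `n` inner vertices is a shortcut for a weight below `D`. -/
def NoShortcut {B : Type} (w : B → B → NNReal) (D : NNReal) (n : ℕ) : Prop :=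
  ∀ l : List B, l.length ≤ n → ∀ a b, w a b < D → w a b ≤ walkCost w a l b

theorem walkCost_append {B : Type} (w : B → B → NNReal) (l₁ l₂ : List B) (a x b : B) :
    walkCost w a (l₁ ++ x :: l₂) b = walkCost w a l₁ x + walkCost w x l₂ b := by
  induction l₁ generalizing a with
  | nil => rfl
  | cons y t ih => simp [walkCost, ih, add_assoc]

theorem walkCost_map {B C : Type} {w : B → B → NNReal} {w' : C → C → NNReal} {g : B → C}
    (hg : ∀ a b, w' (g a) (g b) = w a b) (l : List B) (a b : B) :
    walkCost w' (g a) (l.map g) (g b) = walkCost w a l b := by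
  induction l generalizing a with
  | nil => exact hg a b
  | cons y t ih => simp [walkCost, ih, hg]

theorem walkCost_eq_sum {B : Type} (w : B → B → NNReal) (l : List B) (a b : B) :
    walkCost w a l b = ((a :: l).zipWith w (l ++ [b])).sum := by
  induction l generalizing a with
  | nil => simp [walkCost]
  | cons y t ih => simp [walkCost, ih]

theorem exists_walk_length_mul_le {B : Type} {w : B → B → NNReal} {δ : NNReal}
    (hw : ∀ a b, a ≠ b → δ ≤ w a b) (l : List B) {a b : B} (hab : a ≠ b) :
    ∃ l' : List B, walkCost w a l' b ≤ walkCost w a l b ∧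
      (l'.length + 1) * δ ≤ walkCost w a l' b := by
  induction l generalizing a with
  | nil => exact ⟨[], le_rfl, by simpa [walkCost] using hw a b hab⟩
  | cons x t ih =>
    by_cases hx : x = a
    · subst hx
      obtain ⟨l', h₁, h₂⟩ := ih hab
      exact ⟨l', h₁.trans (by simp [walkCost]), h₂⟩
    by_cases hb : x = b
    · subst hb
      exact ⟨[], by simp [walkCost], by simpa [walkCost] using hw a x hab⟩
    obtain ⟨l', h₁, h₂⟩ := ih hb
    refine ⟨x :: l', by simpa [walkCost] using h₁, ?_⟩
    have := hw a x (Ne.symm hx)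
    simp only [walkCost, List.length_cons]
    push_cast
    calc ((l'.length : NNReal) + 1 + 1) * δ = δ + (l'.length + 1) * δ := by ring
      _ ≤ _ := add_le_add this h₂

theorem NoShortcut.of_large {B : Type} {w : B → B → NNReal} {δ D : NNReal} {n : ℕ}
    (h : NoShortcut w D n) (hself : ∀ a, w a a = 0) (hw : ∀ a b, a ≠ b → δ ≤ w a b)
    (hn : D ≤ n * δ) (l : List B) {a b : B} (hab : w a b < D) : w a b ≤ walkCost w a l b := by
  by_cases hne : a = b
  · subst hne
    simp [hself]
  obtain ⟨l', h₁, h₂⟩ := exists_walk_length_mul_le hw l hne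
  refine le_trans ?_ h₁
  by_cases hl : l'.length ≤ n
  · exact h l' hl a b hab
  · refine hab.le.trans (hn.trans (le_trans ?_ h₂))
    gcongr
    exact_mod_cast (by omega : n ≤ l'.length + 1)

/-- Edge data of a shortcut: a set of vertices and the two ends. -/
abbrev WalkTrace (B : Type) : Type := Set B × B × B

/-- The trace belongs to a shortcut with at most `n` inner vertices. -/
def IsShortcut {B : Type} (w : B → B → NNReal) (D : NNReal) (n : ℕ) (t : WalkTrace B) : Prop :=
  w t.2.1 t.2.2 < D ∧ ∃ l : List B, l.length ≤ n ∧ walkCost w t.2.1 l t.2.2 < w t.2.1 t.2.2 ∧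
    ∀ x ∈ t.1, x = t.2.1 ∨ x = t.2.2 ∨ x ∈ l

/-- `x` and `y` are the two ends of the trace. -/
def WalkTrace.IsEnds {B : Type} (t : WalkTrace B) (x y : B) : Prop :=
  (x = t.2.1 ∧ y = t.2.2) ∨ (x = t.2.2 ∧ y = t.2.1)

/-- The preimage of a trace under a permutation. -/
def WalkTrace.pull {B : Type} (g : Equiv.Perm B) (t : WalkTrace B) : WalkTrace B :=
  (g ⁻¹' t.1, g.symm t.2.1, g.symm t.2.2)

theorem WalkTrace.pull_symm_pull {B : Type} (g : Equiv.Perm B) (t : WalkTrace B) :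
    (t.pull g.symm).pull g = t := by
  ext x <;> simp [WalkTrace.pull]

theorem WalkTrace.pull_surjective {B : Type} (g : Equiv.Perm B) :
    Function.Surjective (WalkTrace.pull g) :=
  fun t => ⟨t.pull g.symm, t.pull_symm_pull g⟩

theorem WalkTrace.isEnds_pull {B : Type} (g : Equiv.Perm B) (t : WalkTrace B) (x y : B) :
    (t.pull g).IsEnds x y ↔ t.IsEnds (g x) (g y) := by
  simp [WalkTrace.IsEnds, WalkTrace.pull, Equiv.eq_symm_apply]

theorem IsShortcut.pull {B : Type} {w : B → B → NNReal} {D : NNReal} {n : ℕ} {t : WalkTrace B}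
    (h : IsShortcut w D n t) {g : Equiv.Perm B} (hg : ∀ a b, w (g a) (g b) = w a b) :
    IsShortcut w D n (t.pull g) := by
  have hg' : ∀ a b, w (g.symm a) (g.symm b) = w a b := fun a b => by
    rw [← hg, g.apply_symm_apply, g.apply_symm_apply]
  obtain ⟨h₁, l, h₂, h₃, h₄⟩ := h
  refine ⟨by simpa [WalkTrace.pull, hg'] using h₁, l.map g.symm, by simpa using h₂, ?_, ?_⟩
  · simpa [WalkTrace.pull, hg', walkCost_map hg'] using h₃
  · intro x hx
    rcases h₄ (g x) hx with h | h | h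
    · exact .inl (by simp [WalkTrace.pull, ← h])
    · exact .inr (.inl (by simp [WalkTrace.pull, ← h]))
    · exact .inr (.inr (List.mem_map.2 ⟨_, h, by simp⟩))

theorem isShortcut_pull_iff {B : Type} {w : B → B → NNReal} {D : NNReal} {n : ℕ}
    {g : Equiv.Perm B} (hg : ∀ a b, w (g a) (g b) = w a b) (t : WalkTrace B) :
    IsShortcut w D n (t.pull g) ↔ IsShortcut w D n t := by
  refine ⟨fun h => ?_, fun h => h.pull hg⟩
  have hg' : ∀ a b, w (g.symm a) (g.symm b) = w a b := fun a b => by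
    rw [← hg, g.apply_symm_apply, g.apply_symm_apply]
  have := h.pull hg'
  rwa [show (t.pull g).pull g.symm = t from t.pull_symm_pull g.symm] at this

/-- The vertices of the unwinding: a vertex together with a sheet for every trace. -/
abbrev Unwinding (B : Type) : Type := B × (WalkTrace B → Prop)

/-- Two vertices of the unwinding are linked when, for every shortcut through both base points,
they lie on different sheets exactly if the base points are its ends. -/
def Linked {B : Type} (w : B → B → NNReal) (D : NNReal) (n : ℕ) (p q : Unwinding B) : Prop :=
  (p.1 = q.1 → p = q) ∧ ∀ t : WalkTrace B, IsShortcut w D n t → p.1 ∈ t.1 → q.1 ∈ t.1 →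
    ((p.2 t ↔ q.2 t) ↔ ¬ t.IsEnds p.1 q.1)

open Classical in
/-- The weight of the unwinding. -/
noncomputable def unwindingWeight {B : Type} (w : B → B → NNReal) (D : NNReal) (n : ℕ)
    (p q : Unwinding B) : NNReal :=
  if Linked w D n p q then w p.1 q.1 else D

theorem IsShortcut.not_isEnds_self {B : Type} {w : B → B → NNReal} {D : NNReal} {n : ℕ}
    {t : WalkTrace B} (ht : IsShortcut w D n t) (hself : ∀ a, w a a = 0) (x : B) :
    ¬ t.IsEnds x x := by
  obtain ⟨-, l, -, h, -⟩ := ht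
  rintro (⟨h₁, h₂⟩ | ⟨h₁, h₂⟩) <;> rw [← h₁, ← h₂, hself] at h <;> exact not_lt_zero h

theorem linked_self {B : Type} {w : B → B → NNReal} {D : NNReal} {n : ℕ}
    (hself : ∀ a, w a a = 0) (p : Unwinding B) : Linked w D n p p :=
  ⟨fun _ => rfl, fun _ ht _ _ => iff_of_true Iff.rfl (ht.not_isEnds_self hself _)⟩

theorem Linked.symm {B : Type} {w : B → B → NNReal} {D : NNReal} {n : ℕ} {p q : Unwinding B}
    (h : Linked w D n p q) : Linked w D n q p := by
  refine ⟨fun hpq => (h.1 hpq.symm).symm, fun t ht hq hp => ?_⟩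
  have := h.2 t ht hp hq
  unfold WalkTrace.IsEnds at *
  tauto

theorem linked_of_unwindingWeight_lt {B : Type} {w : B → B → NNReal} {D : NNReal} {n : ℕ}
    {p q : Unwinding B} (h : unwindingWeight w D n p q < D) :
    Linked w D n p q ∧ unwindingWeight w D n p q = w p.1 q.1 := by
  unfold unwindingWeight at *
  split_ifs at h ⊢ with hl
  · exact ⟨hl, rfl⟩
  · exact absurd h (lt_irrefl _)

/-- Along a walk of the unwinding which is lighter than the ends of a shortcut, the sheet of that
shortcut does not change. -/
theorem sheet_eq_of_walkCost_lt {B : Type} {w : B → B → NNReal} {D : NNReal} {n : ℕ}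
    (hcomm : ∀ a b, w a b = w b a) {t : WalkTrace B} (ht : IsShortcut w D n t)
    (l : List (Unwinding B)) (p q : Unwinding B) (hp : p.1 ∈ t.1) (hq : q.1 ∈ t.1)
    (hl : ∀ x ∈ l, x.1 ∈ t.1)
    (h : walkCost (unwindingWeight w D n) p l q < w t.2.1 t.2.2) : p.2 t ↔ q.2 t := by
  have step : ∀ p q : Unwinding B, p.1 ∈ t.1 → q.1 ∈ t.1 →
      unwindingWeight w D n p q < w t.2.1 t.2.2 → (p.2 t ↔ q.2 t) := by
    intro p q hp hq hpq
    obtain ⟨hl, he⟩ := linked_of_unwindingWeight_lt (hpq.trans ht.1)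
    refine (hl.2 t ht hp hq).2 ?_
    rw [he] at hpq
    rintro (⟨h₁, h₂⟩ | ⟨h₁, h₂⟩)
    · rw [h₁, h₂] at hpq
      exact lt_irrefl _ hpq
    · rw [h₁, h₂, hcomm] at hpq
      exact lt_irrefl _ hpq
  induction l generalizing p with
  | nil => exact step p q hp hq h
  | cons x l ih =>
    have hx := hl x (by simp)
    exact (step p x hp hx (lt_of_le_of_lt le_self_add h)).trans
      (ih x hx (fun y hy => hl y (by simp [hy])) (lt_of_le_of_lt le_add_self h))

theorem walkCost_le_of_le {B C : Type} {w : B → B → NNReal} {w' : C → C → NNReal} {g : B → C}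
    (hg : ∀ a b, w' (g a) (g b) ≤ w a b) (l : List B) (a b : B) :
    walkCost w' (g a) (l.map g) (g b) ≤ walkCost w a l b := by
  induction l generalizing a with
  | nil => exact hg a b
  | cons y t ih => exact add_le_add (hg _ _) (ih _)

theorem noShortcut_unwinding {B : Type} {w : B → B → NNReal} {D : NNReal} {n : ℕ}
    (hcomm : ∀ a b, w a b = w b a) (hle : ∀ a b, w a b ≤ D) :
    NoShortcut (unwindingWeight w D n) D n := by
  intro l hl p q hpq
  by_contra! hlt
  obtain ⟨hlink, he⟩ := linked_of_unwindingWeight_lt hpq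
  have hproj : ∀ p q, w (Prod.fst p) (Prod.fst q) ≤ unwindingWeight w D n p q := by
    intro p q
    unfold unwindingWeight
    split_ifs
    exacts [le_rfl, hle _ _]
  let t : WalkTrace B := ({x | x = p.1 ∨ x = q.1 ∨ x ∈ l.map Prod.fst}, p.1, q.1)
  have ht : IsShortcut w D n t :=
    ⟨by simpa [t, ← he] using hpq, l.map Prod.fst, by simpa using hl,
      by simpa [t, ← he] using (walkCost_le_of_le hproj l p q).trans_lt hlt, fun x hx => hx⟩
  have hp : p.1 ∈ t.1 := .inl rfl
  have hq : q.1 ∈ t.1 := .inr (.inl rfl)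
  have := sheet_eq_of_walkCost_lt hcomm ht l p q hp hq
    (fun x hx => .inr (.inr (List.mem_map_of_mem hx))) (by simpa [t, ← he] using hlt)
  exact (hlink.2 t ht hp hq).1 this (.inl ⟨rfl, rfl⟩)

/-- The copy of `N` in the unwinding. -/
def unwindingEmb {B N : Type} (w : B → B → NNReal) (D : NNReal) (n : ℕ) (e : N → B) (x : N) :
    Unwinding B :=
  (e x, fun t => IsShortcut w D n t ∧ e x ∈ t.1 ∧ e x = t.2.1 ∧ t.2.2 ∈ Set.range e)

theorem IsShortcut.not_mem_range {B N : Type} [MetricSpace N] {w : B → B → NNReal} {D : NNReal}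
    {n : ℕ} {e : N → B} (he : ∀ x y, w (e x) (e y) = nndist x y)
    (hD : ∀ x y : N, nndist x y < D) (hn : NoShortcut w D n) {t : WalkTrace B}
    (ht : IsShortcut w D (n + 1) t) {x y z : N} (hx : e x = t.2.1) (hz : e z = t.2.2)
    (hy : e y ∈ t.1) : e y = e x ∨ e y = e z := by
  obtain ⟨-, l, hl, hlt, hmem⟩ := ht
  rcases hmem _ hy with h | h | h
  · exact .inl (h.trans hx.symm)
  · exact .inr (h.trans hz.symm)
  exfalso
  obtain ⟨l₁, l₂, rfl⟩ := List.append_of_mem h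
  rw [walkCost_append, ← hx, ← hz] at hlt
  simp only [List.length_append, List.length_cons] at hl
  have h₁ := hn l₁ (by omega) (e x) (e y) (by rw [he]; exact hD _ _)
  have h₂ := hn l₂ (by omega) (e y) (e z) (by rw [he]; exact hD _ _)
  have := (add_le_add h₁ h₂).trans_lt hlt
  rw [he, he, he] at this
  exact absurd (nndist_triangle x y z) (not_le.2 this)

theorem linked_unwindingEmb {B N : Type} [MetricSpace N] {w : B → B → NNReal} {D : NNReal}
    {n : ℕ} {e : N → B} (hself : ∀ a, w a a = 0) (he : ∀ x y, w (e x) (e y) = nndist x y)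
    (hD : ∀ x y : N, nndist x y < D) (hn : NoShortcut w D n) (x y : N) :
    Linked w D (n + 1) (unwindingEmb w D (n + 1) e x) (unwindingEmb w D (n + 1) e y) := by
  have hinj : Function.Injective e := fun x y h => by
    have := he x y
    rw [h, hself] at this
    exact nndist_eq_zero.1 this.symm
  refine ⟨fun h => congrArg _ (hinj h), fun t ht hx hy => ?_⟩
  have hends := ht.not_isEnds_self hself
  have key : ∀ x y : N, e x ∈ t.1 → e y ∈ t.1 → x ≠ y → e x = t.2.1 → t.2.2 ∈ Set.range e →
      e y = t.2.2 := by
    rintro x y hx hy hxy h₁ ⟨z, hz⟩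
    rcases ht.not_mem_range he hD hn h₁ hz hy with h | h
    · exact absurd (hinj h).symm hxy
    · exact h.trans hz
  by_cases hxy : x = y
  · subst hxy
    exact iff_of_true Iff.rfl (hends _)
  have k₁ := key x y hx hy hxy
  have k₂ := key y x hy hx (Ne.symm hxy)
  have r₁ : t.2.2 = e x → t.2.2 ∈ Set.range e := fun h => ⟨x, h.symm⟩
  have r₂ : t.2.2 = e y → t.2.2 ∈ Set.range e := fun h => ⟨y, h.symm⟩
  have hne : e x ≠ e y := fun h => hxy (hinj h)
  have hab : t.2.1 ≠ t.2.2 := fun h => hends t.2.1 (.inl ⟨rfl, h⟩)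
  simp only [unwindingEmb, WalkTrace.IsEnds] at *
  grind

/-- The lift of a permutation to the unwinding which swaps the sheets over the traces in `F`. -/
def unwindingLift {B : Type} (g : Equiv.Perm B) (F : Set (WalkTrace B)) (p : Unwinding B) :
    Unwinding B :=
  (g p.1, fun t => p.2 (t.pull g) ↔ (g p.1 ∈ t.1 → t ∉ F))

theorem unwindingLift_injective {B : Type} (g : Equiv.Perm B) (F : Set (WalkTrace B)) :
    Function.Injective (unwindingLift g F) := by
  rintro ⟨x, χ⟩ ⟨y, ψ⟩ h
  obtain ⟨h₁, h₂⟩ := Prod.mk.inj h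
  obtain rfl : x = y := g.injective h₁
  refine Prod.ext rfl (funext fun t => ?_)
  obtain ⟨t, rfl⟩ := WalkTrace.pull_surjective g t
  have := congrFun h₂ t
  simp only [eq_iff_iff] at this ⊢
  tauto

theorem linked_unwindingLift_iff {B : Type} {w : B → B → NNReal} {D : NNReal} {n : ℕ}
    {g : Equiv.Perm B} (hg : ∀ a b, w (g a) (g b) = w a b) (F : Set (WalkTrace B))
    (p q : Unwinding B) :
    Linked w D n (unwindingLift g F p) (unwindingLift g F q) ↔ Linked w D n p q := by
  refine and_congr ?_ ?_
  · rw [(unwindingLift_injective g F).eq_iff]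
    exact imp_congr_left g.injective.eq_iff
  · refine Iff.trans (forall_congr' fun t => ?_) (WalkTrace.pull_surjective g).forall.symm
    rw [isShortcut_pull_iff hg, WalkTrace.isEnds_pull]
    refine imp_congr_right fun _ => imp_congr_right fun hp => imp_congr_right fun hq => ?_
    refine iff_congr ?_ Iff.rfl
    change g p.1 ∈ t.1 at hp
    change g q.1 ∈ t.1 at hq
    simp only [unwindingLift, hp, hq, true_imp_iff]
    tauto

theorem unwindingLift_unwindingEmb {M N B : Type} [MetricSpace M] [MetricSpace N]
    {w : B → B → NNReal} {D : NNReal}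
    {n : ℕ} {e : N → B} (hself : ∀ a, w a a = 0) (he : ∀ x y, w (e x) (e y) = nndist x y)
    (hD : ∀ x y : N, nndist x y < D) (hn : NoShortcut w D n) {τ τ' : M → N} {g : Equiv.Perm B}
    (hg : ∀ a b, w (g a) (g b) = w a b) (hgτ : ∀ m, g (e (τ m)) = e (τ' m)) :
    ∃ F, ∀ m, unwindingLift g F (unwindingEmb w D (n + 1) e (τ m)) =
      unwindingEmb w D (n + 1) e (τ' m) := by
  set s : N → Unwinding B := unwindingEmb w D (n + 1) e with hs
  have hout : ∀ x t, (s x).2 t → IsShortcut w D (n + 1) t ∧ e x ∈ t.1 := fun x t h => ⟨h.1, h.2.1⟩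
  refine ⟨{t | ∃ m, e (τ' m) ∈ t.1 ∧ ¬ ((s (τ m)).2 (t.pull g) ↔ (s (τ' m)).2 t)}, fun m => ?_⟩
  refine Prod.ext (hgτ m) (funext fun t => ?_)
  have hfst : ∀ x, (s x).1 = e x := fun _ => rfl
  simp only [unwindingLift, hfst, hgτ, Set.mem_ofPred_eq, eq_iff_iff]
  have hmem : ∀ m, e (τ m) ∈ (t.pull g).1 ↔ e (τ' m) ∈ t.1 := fun m => by
    rw [← hgτ]
    rfl
  have h₁ := hout (τ m) (t.pull g)
  have h₂ := hout (τ' m) t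
  rw [isShortcut_pull_iff hg, hmem] at h₁
  by_cases ht : IsShortcut w D (n + 1) t ∧ e (τ' m) ∈ t.1
  · obtain ⟨ht, hm⟩ := ht
    have hconst : ∀ m', e (τ' m') ∈ t.1 →
        (((s (τ m)).2 (t.pull g) ↔ (s (τ' m)).2 t) ↔
          ((s (τ m')).2 (t.pull g) ↔ (s (τ' m')).2 t)) := by
      intro m' hm'
      have a₁ := (linked_unwindingEmb hself he hD hn (τ m) (τ m')).2 (t.pull g) (ht.pull hg)
        ((hmem m).2 hm) ((hmem m').2 hm')
      have a₂ := (linked_unwindingEmb hself he hD hn (τ' m) (τ' m')).2 t ht hm hm'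
      rw [WalkTrace.isEnds_pull] at a₁
      simp only [← hs, hfst, hgτ] at a₁ a₂
      tauto
    have hF : (∃ m, e (τ' m) ∈ t.1 ∧ ¬ ((s (τ m)).2 (t.pull g) ↔ (s (τ' m)).2 t)) ↔
        ¬ ((s (τ m)).2 (t.pull g) ↔ (s (τ' m)).2 t) :=
      ⟨fun ⟨m', h, h'⟩ => (hconst m' h).not.2 h', fun h => ⟨m, hm, h⟩⟩
    rw [hF]
    tauto
  · have : ¬ (e (τ' m) ∈ t.1 ∧
        ∃ m, e (τ' m) ∈ t.1 ∧ ¬ ((s (τ m)).2 (t.pull g) ↔ (s (τ' m)).2 t)) ∨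
        IsShortcut w D (n + 1) t ∧ e (τ' m) ∈ t.1 := by
      by_contra! hcon
      obtain ⟨⟨hm, m', hm', hne⟩, -⟩ := hcon
      have b₁ := hout (τ m') (t.pull g)
      have b₂ := hout (τ' m') t
      rw [isShortcut_pull_iff hg] at b₁
      tauto
    tauto

theorem IsExtensionWitness.unwinding {M N : Type} [MetricSpace M] [MetricSpace N] {δ D : NNReal}
    {B : Type} [Finite B] {w : B → B → NNReal} {e : N → B} (h : IsExtensionWitness M N δ D w e)
    (hD : ∀ x y : N, nndist x y < D) (hδ : δ ≤ D) {n : ℕ} (hn : NoShortcut w D n) :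
    IsExtensionWitness M N δ D (unwindingWeight w D (n + 1)) (unwindingEmb w D (n + 1) e) where
  self p := by rw [unwindingWeight, if_pos (linked_self h.self p), h.self]
  comm p q := by
    classical exact if_congr ⟨Linked.symm, Linked.symm⟩ (h.comm _ _) rfl
  le_of_ne p q hpq := by
    unfold unwindingWeight
    split_ifs with hl
    · exact h.le_of_ne _ _ fun h' => hpq (hl.1 h')
    · exact hδ
  le p q := by
    unfold unwindingWeight
    split_ifs
    exacts [h.le _ _, le_rfl]
  map_eq x y := by
    rw [unwindingWeight, if_pos (linked_unwindingEmb h.self h.map_eq hD hn x y)]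
    exact h.map_eq x y
  extend τ τ' hτ hτ' := by
    obtain ⟨g, hg, hgτ⟩ := h.extend τ τ' hτ hτ'
    obtain ⟨F, hF⟩ := unwindingLift_unwindingEmb h.self h.map_eq hD hn hg hgτ
    refine ⟨Equiv.ofBijective _ (Finite.injective_iff_bijective.1 (unwindingLift_injective g F)),
      fun p q => ?_, hF⟩
    classical exact if_congr (linked_unwindingLift_iff hg F p q) (hg _ _) rfl

open Classical in
/-- The indicator of the pairs which have the same distance as `x` and `y`. -/
noncomputable def distIndicator {N : Type} [MetricSpace N] (x y : N) : N × N → ZMod 3 :=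
  fun p => if nndist p.1 p.2 = nndist x y then 1 else 0

theorem distIndicator_congr {N : Type} [MetricSpace N] {x y x' y' : N}
    (h : nndist x y = nndist x' y') : distIndicator x y = distIndicator x' y' := by
  funext p
  simp only [distIndicator, h]

theorem nndist_eq_of_distIndicator {N : Type} [MetricSpace N] {x y x' y' : N}
    (h : distIndicator x y + distIndicator x y = distIndicator x' y' + distIndicator x' y') :
    nndist x y = nndist x' y' := by
  have := congrFun h (x, y)
  simp only [distIndicator, Pi.add_apply, if_true] at this
  split_ifs at this with h'
  · exact h'
  · exact absurd this (by decide)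

open Classical in
/-- The weight encoded by twice the indicator of a positive distance, and `D` for other labels. -/
noncomputable def labelWeight {N : Type} [MetricSpace N] (D : NNReal) (a : N × N → ZMod 3) :
    NNReal :=
  if h : ∃ p : N × N, p.1 ≠ p.2 ∧ a = distIndicator p.1 p.2 + distIndicator p.1 p.2
  then nndist h.choose.1 h.choose.2 else D

theorem labelWeight_distIndicator {N : Type} [MetricSpace N] (D : NNReal) {x y : N} (h : x ≠ y) :
    labelWeight D (distIndicator x y + distIndicator x y) = nndist x y := by
  have hex : ∃ p : N × N, p.1 ≠ p.2 ∧
      distIndicator x y + distIndicator x y = distIndicator p.1 p.2 + distIndicator p.1 p.2 :=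
    ⟨(x, y), h, rfl⟩
  rw [labelWeight, dif_pos hex]
  exact (nndist_eq_of_distIndicator hex.choose_spec.2).symm

open Classical in
/-- The weight on pairs of a point and a choice of half labels. -/
noncomputable def valuationWeight {N : Type} [MetricSpace N] (D : NNReal)
    (p q : N × (N → N × N → ZMod 3)) : NNReal :=
  if p.1 = q.1 then (if p = q then 0 else D) else labelWeight D (p.2 q.1 + q.2 p.1)

theorem isExtensionWitness_valuation (M N : Type) [MetricSpace M] [MetricSpace N] [Finite N]
    {δ D : NNReal} (hδ : ∀ x y : N, x ≠ y → δ ≤ nndist x y) (hD : ∀ x y : N, nndist x y ≤ D)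
    (hδD : δ ≤ D) :
    IsExtensionWitness M N δ D (valuationWeight D) (fun x : N => (x, distIndicator x)) where
  self p := by simp [valuationWeight]
  comm p q := by
    classical exact if_congr eq_comm (if_congr eq_comm rfl rfl) (congrArg _ (add_comm _ _))
  le_of_ne p q hpq := by
    unfold valuationWeight labelWeight
    split_ifs with h₁ h₂
    exacts [hδD, hδ _ _ h₂.choose_spec.1, hδD]
  le p q := by
    unfold valuationWeight labelWeight
    split_ifs
    exacts [zero_le, le_rfl, hD _ _, le_rfl]
  map_eq x y := by
    by_cases h : x = y
    · subst h
      simp [valuationWeight]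
    · simp only [valuationWeight, h, if_false]
      rw [distIndicator_congr (nndist_comm y x), labelWeight_distIndicator D h]
  extend τ τ' hτ hτ' := by
    classical
    have inj : ∀ τ : M → N, IsIsomEmb τ → Function.Injective τ := fun τ h x y hxy => by
      rw [← dist_eq_zero, ← h, hxy, dist_self]
    have := Finite.of_injective τ (inj τ hτ)
    obtain ⟨σ, hσ⟩ := Equiv.Perm.exists_extending_pair τ τ' (inj τ hτ) (inj τ' hτ')
    let c : N → ZMod 3 := fun x => if x ∈ Set.range τ then 1 else 0
    let u : N → N → N × N → ZMod 3 := fun x y =>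
      (c x - c y) • (distIndicator (σ x) (σ y) - distIndicator x y)
    have hu : ∀ x y, u x y + u y x = 0 := fun x y => by
      simp only [u, distIndicator_congr (nndist_comm (σ y) (σ x)),
        distIndicator_congr (nndist_comm y x)]
      rw [← add_smul]
      simp
    have huτ : ∀ m y, u (τ m) y = distIndicator (σ (τ m)) (σ y) - distIndicator (τ m) y := by
      intro m y
      by_cases hy : y ∈ Set.range τ
      · obtain ⟨m', rfl⟩ := hy
        have : nndist (σ (τ m)) (σ (τ m')) = nndist (τ m) (τ m') := by
          ext
          rw [coe_nndist, coe_nndist, hσ, hσ, hτ, hτ']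
        simp [u, distIndicator_congr this]
      · have hcy : c y = 0 := if_neg hy
        have hcm : c (τ m) = 1 := if_pos ⟨m, rfl⟩
        simp [u, hcy, hcm]
    let G : N × (N → N × N → ZMod 3) → N × (N → N × N → ZMod 3) :=
      fun p => (σ p.1, fun z => p.2 (σ.symm z) + u p.1 (σ.symm z))
    have hG : Function.Injective G := by
      rintro ⟨x, χ⟩ ⟨y, ψ⟩ h
      obtain ⟨h₁, h₂⟩ := Prod.mk.inj h
      obtain rfl : x = y := σ.injective h₁
      refine Prod.ext rfl (funext fun z => ?_)
      simpa using congrFun h₂ (σ z)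
    refine ⟨Equiv.ofBijective G (Finite.injective_iff_bijective.1 hG), fun p q => ?_, fun m => ?_⟩
    · refine if_congr σ.injective.eq_iff (if_congr hG.eq_iff rfl rfl) (congrArg _ ?_)
      simp only [Equiv.ofBijective_apply, G, Equiv.symm_apply_apply]
      rw [add_add_add_comm, hu, add_zero]
    · refine Prod.ext (hσ m) (funext fun z => ?_)
      simp [G, huτ, hσ]

theorem exists_noShortcut_witness (M N : Type) [MetricSpace M] [MetricSpace N] [Finite N]
    {δ D : NNReal} (hδ : ∀ x y : N, x ≠ y → δ ≤ nndist x y) (hD : ∀ x y : N, nndist x y < D)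
    (hδD : δ ≤ D) (n : ℕ) :
    ∃ (B : Type) (_ : Finite B) (w : B → B → NNReal) (e : N → B),
      IsExtensionWitness M N δ D w e ∧ NoShortcut w D n := by
  induction n with
  | zero =>
    refine ⟨_, inferInstance, _, _,
      isExtensionWitness_valuation M N hδ (fun x y => (hD x y).le) hδD, ?_⟩
    intro l hl a b _
    rw [List.eq_nil_of_length_eq_zero (Nat.le_zero.1 hl)]
    rfl
  | succ n ih =>
    obtain ⟨B, _, w, e, h, hn⟩ := ih
    exact ⟨_, inferInstance, _, _, h.unwinding hD hδD hn, noShortcut_unwinding h.comm h.le⟩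

/-- Every finite metric space `N` embeds into a finite metric space in which all copies of `M`
inside `N` are exchanged by isometries. -/
theorem exists_finite_extension (M N : Type) [MetricSpace M] [MetricSpace N] [Finite N] :
    ∃ (Z : Type) (_ : MetricSpace Z) (_ : Finite Z) (e : N → Z), IsIsomEmb e ∧
      ∀ τ τ' : M → N, IsIsomEmb τ → IsIsomEmb τ' → ∃ g : Z ≃ᵢ Z, ∀ m, g (e (τ m)) = e (τ' m) := by
  obtain ⟨D, hD⟩ : ∃ D : NNReal, ∀ x y : N, nndist x y < D := by
    obtain ⟨D, hD⟩ := (Set.finite_range fun p : N × N => nndist p.1 p.2).bddAbove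
    exact ⟨D + 1, fun x y => (hD ⟨(x, y), rfl⟩).trans_lt (lt_add_one D)⟩
  obtain ⟨δ, hδ0, hδ⟩ : ∃ δ : NNReal, 0 < δ ∧ ∀ x y : N, x ≠ y → δ ≤ nndist x y := by
    obtain h | h := isEmpty_or_nonempty {p : N × N // p.1 ≠ p.2}
    · exact ⟨1, one_pos, fun x y hxy => h.elim ⟨(x, y), hxy⟩⟩
    · obtain ⟨p, hp⟩ := Finite.exists_min fun p : {p : N × N // p.1 ≠ p.2} => nndist p.1.1 p.1.2
      exact ⟨_, pos_iff_ne_zero.2 (nndist_eq_zero.not.2 p.2), fun x y hxy => hp ⟨(x, y), hxy⟩⟩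
  have hδ' : ∀ x y : N, x ≠ y → min δ D ≤ nndist x y := fun x y h =>
    (min_le_left _ _).trans (hδ x y h)
  obtain hN | ⟨⟨x₀⟩⟩ := isEmpty_or_nonempty N
  · exact ⟨N, inferInstance, inferInstance, id, fun _ _ => rfl, fun τ τ' _ _ =>
      ⟨IsometryEquiv.refl N, fun m => hN.elim (τ m)⟩⟩
  have hD0 : 0 < D := zero_le.trans_lt (hD x₀ x₀)
  obtain ⟨n, hn⟩ := Archimedean.arch D (lt_min hδ0 hD0)
  obtain ⟨B, _, w, e, h, hs⟩ := exists_noShortcut_witness M N hδ' hD (min_le_right _ _) n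
  let _ : PseudoMetricSpace B := PseudoMetricSpace.ofPreNNDist w h.self h.comm
  have hdist : ∀ a b : B, dist a b = ((⨅ l : List B, walkCost w a l b : NNReal) : ℝ) := by
    intro a b
    simp only [walkCost_eq_sum]
    rfl
  have hdist_le : ∀ a b : B, dist a b ≤ w a b := PseudoMetricSpace.dist_ofPreNNDist_le w _ _
  have hpos : ∀ a b : B, dist a b = 0 → a = b := by
    intro a b hab
    by_contra hne
    rw [hdist, NNReal.coe_eq_zero] at hab
    refine (lt_min hδ0 hD0).not_ge (hab ▸ le_ciInf fun l => ?_)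
    obtain ⟨l', h₁, h₂⟩ := exists_walk_length_mul_le h.le_of_ne l hne
    exact (le_mul_of_one_le_left zero_le le_add_self).trans (h₂.trans h₁)
  have hiso : ∀ g : Equiv.Perm B, (∀ a b, w (g a) (g b) = w a b) →
      ∀ a b, dist (g a) (g b) ≤ dist a b := by
    intro g hg a b
    rw [hdist, hdist, NNReal.coe_le_coe]
    refine le_ciInf fun l => ?_
    rw [← walkCost_map hg]
    exact ciInf_le (OrderBot.bddBelow _) _
  refine ⟨B, { eq_of_dist_eq_zero := hpos _ _ }, inferInstance, e, fun x y => le_antisymm ?_ ?_,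
    fun τ τ' hτ hτ' => ?_⟩
  · exact (hdist_le _ _).trans_eq (by rw [h.map_eq, coe_nndist])
  · change dist x y ≤ dist (e x) (e y)
    rw [hdist, ← coe_nndist, NNReal.coe_le_coe, ← h.map_eq]
    exact le_ciInf fun l => hs.of_large h.self h.le_of_ne (by simpa using hn) l
      (by rw [h.map_eq]; exact hD x y)
  · obtain ⟨g, hg, hgτ⟩ := h.extend τ τ' hτ hτ'
    have hg' : ∀ a b, w (g.symm a) (g.symm b) = w a b := fun a b => by
      rw [← hg, g.apply_symm_apply, g.apply_symm_apply]
    refine ⟨IsometryEquiv.mk g (Isometry.of_dist_eq fun a b => le_antisymm (hiso g hg a b) ?_), hgτ⟩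
    simpa using hiso g.symm hg' (g a) (g b)

/-- A function on a finite product which changes by at most one when a single coordinate is
changed has variance at most the number of coordinates. -/
theorem exists_sum_sub_sq_le {Γ : Type} [Fintype Γ] [Nonempty Γ] (n : ℕ) (f : (Fin n → Γ) → ℝ)
    (hf : ∀ g i a, |f (Function.update g i a) - f g| ≤ 1) :
    ∃ m : ℝ, ∑ g, (f g - m) ^ 2 ≤ n * Fintype.card (Fin n → Γ) := by
  induction n with
  | zero => exact ⟨f default, by simp [Subsingleton.elim _ (default : Fin 0 → Γ)]⟩
  | succ n ih =>
    set K : ℝ := (Fintype.card Γ : ℝ) with hK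
    have hK0 : 0 < K := by
      rw [hK]
      exact_mod_cast Fintype.card_pos
    let F : (Fin n → Γ) → ℝ := fun y => (∑ x, f (Fin.cons x y)) / K
    have hsum : ∀ y, ∑ x, (f (Fin.cons x y) - F y) = 0 := fun y => by
      simp only [Finset.sum_sub_distrib, Finset.sum_const, Finset.card_univ, nsmul_eq_mul, ← hK, F]
      field_simp
      ring
    have havg : ∀ (h : Γ → ℝ), (∀ x, |h x| ≤ 1) → |(∑ x, h x) / K| ≤ 1 := fun h hh => by
      rw [abs_div, abs_of_pos hK0, div_le_one hK0]
      refine (Finset.abs_sum_le_sum_abs _ _).trans ((Finset.sum_le_sum fun x _ => hh x).trans ?_)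
      simp [hK]
    have hF : ∀ y i a, |F (Function.update y i a) - F y| ≤ 1 := fun y i a => by
      simp only [F, ← sub_div, ← Finset.sum_sub_distrib]
      refine havg _ fun x => ?_
      have h := hf (Fin.cons x y) i.succ a
      rwa [← Fin.cons_update (α := fun _ => Γ)] at h
    have hfF : ∀ x y, |f (Fin.cons x y) - F y| ≤ 1 := fun x y => by
      have : f (Fin.cons x y) - F y = (∑ x', (f (Fin.cons x y) - f (Fin.cons x' y))) / K := by
        simp only [Finset.sum_sub_distrib, Finset.sum_const, Finset.card_univ, nsmul_eq_mul,
          ← hK, F]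
        field_simp
      rw [this]
      refine havg _ fun x' => ?_
      have h := hf (Fin.cons x' y) 0 x
      rwa [Fin.update_cons_zero (α := fun _ => Γ)] at h
    obtain ⟨m, hm⟩ := ih F hF
    refine ⟨m, ?_⟩
    have hcard : (Fintype.card (Fin (n + 1) → Γ) : ℝ) = K * Fintype.card (Fin n → Γ) := by
      simp [hK, pow_succ, mul_comm]
    have hfibre : ∀ y, ∑ x, (f (Fin.cons x y) - m) ^ 2 ≤ K + K * (F y - m) ^ 2 := fun y => by
      have : ∀ x, (f (Fin.cons x y) - m) ^ 2 =
          (f (Fin.cons x y) - F y) ^ 2 + 2 * (F y - m) * (f (Fin.cons x y) - F y) +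
            (F y - m) ^ 2 := fun x => by ring
      simp only [this, Finset.sum_add_distrib, ← Finset.mul_sum, hsum, mul_zero, add_zero,
        Finset.sum_const, Finset.card_univ, nsmul_eq_mul, ← hK]
      gcongr
      calc ∑ x, (f (Fin.cons x y) - F y) ^ 2 ≤ ∑ _x : Γ, (1 : ℝ) :=
            Finset.sum_le_sum fun x _ => (sq_le_one_iff_abs_le_one _).2 (hfF x y)
        _ = K := by simp [hK]
    calc ∑ g, (f g - m) ^ 2 = ∑ y, ∑ x, (f (Fin.cons x y) - m) ^ 2 := by
          rw [← (Fin.consEquiv fun _ : Fin (n + 1) => Γ).sum_comp, Fintype.sum_prod_type_right]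
          rfl
      _ ≤ ∑ y : Fin n → Γ, (K + K * (F y - m) ^ 2) := Finset.sum_le_sum fun y _ => hfibre y
      _ = K * Fintype.card (Fin n → Γ) + K * ∑ y, (F y - m) ^ 2 := by
          rw [Finset.sum_add_distrib, ← Finset.mul_sum]
          simp [mul_comm]
      _ ≤ K * Fintype.card (Fin n → Γ) + K * (n * Fintype.card (Fin n → Γ)) := by gcongr
      _ = _ := by
          rw [hcard]
          push_cast
          ring

open Classical in
/-- Concentration in products: for large `n`, all but a `1 / k` fraction of a finite power `Γ ^ n`
lies within Hamming distance `η * n` of any set of density at least `1 / r`. -/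
theorem card_far_mul_lt {Γ : Type} [Fintype Γ] [Nonempty Γ] {n r k : ℕ} {η : ℝ} (hη : 0 < η)
    (hr : 4 * r ≤ η ^ 2 * n) (hk : 4 * k < η ^ 2 * n) (A : Finset (Fin n → Γ))
    (hA : Fintype.card (Fin n → Γ) ≤ r * A.card) :
    {g : Fin n → Γ | ∀ a ∈ A, η * n ≤ hammingDist g a}.toFinset.card * k <
      Fintype.card (Fin n → Γ) := by
  set c := Fintype.card (Fin n → Γ) with hc
  have hc0 : 0 < c := Fintype.card_pos
  have hApos : 0 < A.card := Nat.pos_of_ne_zero fun h => by simp [h] at hA; omega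
  have hAne : A.Nonempty := Finset.card_pos.1 hApos
  let f : (Fin n → Γ) → ℝ := fun g => A.inf' hAne fun a => (hammingDist g a : ℝ)
  have hlip : ∀ g h : Fin n → Γ, f g ≤ hammingDist g h + f h := fun g h => by
    obtain ⟨a, ha, hfa⟩ := A.exists_mem_eq_inf' hAne fun a => (hammingDist h a : ℝ)
    refine (Finset.inf'_le _ ha).trans ?_
    change _ ≤ _ + A.inf' hAne fun a => (hammingDist h a : ℝ)
    rw [hfa]
    exact_mod_cast hammingDist_triangle g h a
  have hupd : ∀ (g : Fin n → Γ) i a, hammingDist (Function.update g i a) g ≤ 1 := fun g i a => by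
    refine (Finset.card_le_card (t := {i}) fun j hj => ?_).trans (Finset.card_singleton i).le
    by_contra hne
    simp only [Finset.mem_singleton] at hne
    simp [Function.update_of_ne hne] at hj
  obtain ⟨m, hm⟩ := exists_sum_sub_sq_le n f fun g i a => by
    have h₁ := hlip (Function.update g i a) g
    have h₂ := hlip g (Function.update g i a)
    rw [hammingDist_comm] at h₂
    have h₃ : (hammingDist (Function.update g i a) g : ℝ) ≤ 1 := by exact_mod_cast hupd g i a
    rw [abs_le]
    constructor <;> linarith
  rw [← hc] at hm
  have hfA : ∀ a ∈ A, f a = 0 := fun a ha => by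
    refine le_antisymm ((Finset.inf'_le _ ha).trans_eq (by simp)) ?_
    exact (Finset.le_inf'_iff _ _).2 fun b _ => Nat.cast_nonneg _
  have hcR : (0 : ℝ) < c := by exact_mod_cast hc0
  have hsub : ∀ S : Finset (Fin n → Γ), ∑ g ∈ S, (f g - m) ^ 2 ≤ n * c := fun S =>
    (Finset.sum_le_sum_of_subset_of_nonneg (Finset.subset_univ S)
      fun _ _ _ => sq_nonneg _).trans hm
  have hn0 : (0 : ℝ) < n := by
    by_contra! h
    have h0 : (n : ℝ) = 0 := le_antisymm h (Nat.cast_nonneg n)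
    rw [h0, mul_zero] at hk
    exact absurd hk (not_lt.2 (by positivity))
  have hm2 : m ^ 2 ≤ n * r := by
    have h₁ : A.card * m ^ 2 ≤ n * c := by
      refine le_trans (le_of_eq ?_) (hsub A)
      rw [Finset.sum_congr rfl fun a ha => by rw [hfA a ha, zero_sub, neg_sq]]
      simp
    have h₂ : (c : ℝ) ≤ r * A.card := by exact_mod_cast hA
    have h₃ : (0 : ℝ) < A.card := by exact_mod_cast hApos
    refine le_of_mul_le_mul_left ?_ h₃
    calc A.card * m ^ 2 ≤ n * c := h₁
      _ ≤ n * (r * A.card) := by gcongr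
      _ = A.card * (n * r) := by ring
  have hmle : m ≤ η * n / 2 := by
    refine (le_abs_self m).trans (abs_le_of_sq_le_sq ?_ (by positivity))
    nlinarith
  set T := {g : Fin n → Γ | ∀ a ∈ A, η * n ≤ hammingDist g a}.toFinset with hT
  have hTsum : T.card * (η * n / 2) ^ 2 ≤ n * c := by
    refine le_trans ?_ (hsub T)
    rw [← nsmul_eq_mul]
    refine Finset.card_nsmul_le_sum _ _ _ fun g hg => ?_
    have : η * n ≤ f g := (Finset.le_inf'_iff _ _).2 (by simpa [hT] using hg)
    have : η * n / 2 ≤ f g - m := by linarith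
    gcongr
  rify
  by_contra! hcon
  rcases Nat.eq_zero_or_pos T.card with h0 | h0
  · rw [h0] at hcon
    simp at hcon
    linarith
  · have h0 : (0 : ℝ) < T.card := by exact_mod_cast h0
    have h₁ : T.card * (η ^ 2 * n) ≤ 4 * c := by
      refine le_of_mul_le_mul_left ?_ hn0
      nlinarith
    nlinarith

/-- A subset of density less than `1 / |E|` in a finite group misses some left translate of any
family indexed by `E`. -/
theorem exists_forall_mul_notMem {H E : Type} [Group H] [Fintype H] [Fintype E] (γ : E → H)
    (T : Finset H) (hT : T.card * Fintype.card E < Fintype.card H) : ∃ g, ∀ τ, g * γ τ ∉ T := by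
  classical
  by_contra! hcon
  refine hT.not_ge ?_
  have hcover : (Finset.univ : Finset H) ⊆
      Finset.univ.biUnion fun τ => T.image fun g => g * (γ τ)⁻¹ := fun g _ => by
    obtain ⟨τ, hτ⟩ := hcon g
    simp only [Finset.mem_biUnion, Finset.mem_univ, true_and, Finset.mem_image]
    exact ⟨τ, _, hτ, by simp⟩
  calc Fintype.card H ≤ _ := Finset.card_le_card hcover
    _ ≤ Fintype.card E * T.card := Finset.card_biUnion_le_card_mul _ _ _ fun τ _ =>
        Finset.card_image_le
    _ = _ := mul_comm _ _

open Classical in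
/-- For large `n`, every colouring of the power `Γ ^ n` of a finite group has a colour class which
comes close to all the points of some left translate of a given finite family of constants. -/
theorem exists_translate_hammingDist_lt {Γ E : Type} [Group Γ] [Fintype Γ] [Fintype E] (γ : E → Γ)
    {n r : ℕ} {η : ℝ} (hη : 0 < η) (hn : 4 * (r + Fintype.card E) < η ^ 2 * n)
    (col : (Fin n → Γ) → Fin r) :
    ∃ (i : Fin r) (g : Fin n → Γ), ∀ τ, ∃ h, col h = i ∧
      hammingDist (fun j => g j * γ τ) h < η * n := by
  have : Nonempty (Fin r) := ⟨col 1⟩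
  obtain ⟨i, -, hi⟩ : ∃ i ∈ Finset.univ, Fintype.card (Fin n → Γ) ≤
      r * (Finset.univ.filter fun g => col g = i).card := by
    by_contra! hcon
    have h₁ := Finset.sum_lt_sum_of_nonempty Finset.univ_nonempty hcon
    rw [← Finset.mul_sum, Finset.sum_const, Finset.card_univ, Fintype.card_fin, smul_eq_mul,
      ← Finset.card_eq_sum_card_fiberwise fun g _ => Finset.mem_coe.2 (Finset.mem_univ (col g)),
      Finset.card_univ] at h₁
    exact lt_irrefl _ h₁
  have hfar := card_far_mul_lt hη (n := n) (r := r) (k := Fintype.card E)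
    (by linarith [(Nat.cast_nonneg (Fintype.card E) : (0 : ℝ) ≤ _)])
    (by linarith [(Nat.cast_nonneg r : (0 : ℝ) ≤ _)]) _ hi
  obtain ⟨g, hg⟩ := exists_forall_mul_notMem (fun τ _ => γ τ) _ hfar
  refine ⟨i, g, fun τ => ?_⟩
  obtain ⟨h, hcol, hdist⟩ : ∃ h, col h = i ∧ hammingDist (g * fun _ => γ τ) h < η * n := by
    simpa using hg τ
  exact ⟨h, hcol, hdist⟩

/-- The power `Z ^ n` with the average of the coordinate distances. -/
noncomputable abbrev averageMetric (Z : Type) [MetricSpace Z] (n : ℕ) (hn : n ≠ 0) :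
    MetricSpace (Fin n → Z) where
  dist x y := (∑ i, dist (x i) (y i)) / n
  dist_self x := by simp
  dist_comm x y := by simp only [dist_comm]
  dist_triangle x y z := by
    rw [← add_div, ← Finset.sum_add_distrib]
    gcongr
    exact dist_triangle _ _ _
  eq_of_dist_eq_zero {x y} h := by
    have hn' : (n : ℝ) ≠ 0 := Nat.cast_ne_zero.2 hn
    have h : (∑ i, dist (x i) (y i)) / (n : ℝ) = 0 := h
    rw [div_eq_zero_iff, or_iff_left hn', Finset.sum_eq_zero_iff_of_nonneg fun _ _ => dist_nonneg]
      at h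
    exact funext fun i => dist_eq_zero.1 (h i (Finset.mem_univ i))

theorem isIsomEmb_pi {M Z : Type} [MetricSpace M] [MetricSpace Z] {n : ℕ} (hn : n ≠ 0)
    {f : Fin n → M → Z} (hf : ∀ i, IsIsomEmb (f i)) :
    letI := averageMetric Z n hn
    IsIsomEmb fun x i => f i x := by
  intro x y
  change (∑ i, dist (f i x) (f i y)) / (n : ℝ) = _
  have hn' : (n : ℝ) ≠ 0 := Nat.cast_ne_zero.2 hn
  simp only [fun i => hf i x y, Finset.sum_const, Finset.card_univ, Fintype.card_fin, nsmul_eq_mul]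
  field_simp

theorem sum_dist_le_hammingDist_mul {Γ Z : Type} [MetricSpace Z] [DecidableEq Γ] {n : ℕ}
    (F : Γ → Z) {C : ℝ} (hC : ∀ a b : Z, dist a b ≤ C) (g h : Fin n → Γ) :
    ∑ i, dist (F (g i)) (F (h i)) ≤ hammingDist g h * C := by
  rw [hammingDist, ← nsmul_eq_mul, ← Finset.sum_const, Finset.sum_filter]
  refine Finset.sum_le_sum fun i _ => ?_
  split_ifs with hi
  · exact hC _ _
  · rw [not_not.1 hi, dist_self]

/-- The approximate Ramsey property of finite metric spaces (Pestov): for all finite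
metric spaces `M`, `N`, every `r ∈ ℕ`, and every `ε > 0` there is a finite metric space
`P` such that every `r`-coloring of the isometric embeddings `emb(M,P)` admits
`σ ∈ emb(N,P)` with `σ ∘ emb(M,N)` ε-monochromatic: for some color `i`, every
`σ ∘ τ` with `τ ∈ emb(M,N)` lies within sup-distance `ε` of an embedding of color `i`. -/
theorem approximate_ramsey_finite_metric_spaces
    (M N : Type) [MetricSpace M] [Fintype M] [MetricSpace N] [Fintype N]
    (r : ℕ) (ε : ℝ) (hε : 0 < ε) :
    ∃ (P : Type) (_ : MetricSpace P) (_ : Fintype P),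
      ∀ c : (M → P) → Fin r,
        ∃ σ : N → P, IsIsomEmb σ ∧
          ∃ i : Fin r, ∀ τ : M → N, IsIsomEmb τ →
            ∃ ρ : M → P, IsIsomEmb ρ ∧ c ρ = i ∧
              ∀ x : M, dist (σ (τ x)) (ρ x) ≤ ε := by
  classical
  by_cases hτ₀ : ∃ τ₀ : M → N, IsIsomEmb τ₀
  swap
  · obtain hN | ⟨⟨x₀⟩⟩ := isEmpty_or_nonempty N
    · exact ⟨Unit, inferInstance, inferInstance, fun c => ⟨fun _ => (), fun x => hN.elim x,
        c fun _ => (), fun τ hτ => (hτ₀ ⟨τ, hτ⟩).elim⟩⟩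
    · exact ⟨N, inferInstance, inferInstance, fun c => ⟨id, fun _ _ => rfl,
        c fun _ => x₀, fun τ hτ => (hτ₀ ⟨τ, hτ⟩).elim⟩⟩
  obtain ⟨τ₀, hτ₀⟩ := hτ₀
  obtain ⟨Z, _, _, e, he, hext⟩ := exists_finite_extension M N
  obtain ⟨C, hC0, hC⟩ : ∃ C : ℝ, 0 < C ∧ ∀ a b : Z, dist a b ≤ C := by
    obtain ⟨C, hC⟩ := (Set.finite_range fun p : Z × Z => dist p.1 p.2).bddAbove
    exact ⟨max C 1, by positivity, fun a b => (hC ⟨(a, b), rfl⟩).trans (le_max_left _ _)⟩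
  have : Finite (Z ≃ᵢ Z) := DFunLike.finite _
  let _ := Fintype.ofFinite (Z ≃ᵢ Z)
  let _ := Fintype.ofFinite Z
  let E := {τ : M → N // IsIsomEmb τ}
  set η := ε / C with hη
  have hη0 : 0 < η := by positivity
  obtain ⟨n, hn⟩ := exists_nat_gt (4 * (r + Fintype.card E) / η ^ 2)
  rw [div_lt_iff₀' (by positivity)] at hn
  have hn0 : n ≠ 0 := by
    rintro rfl
    rw [Nat.cast_zero, mul_zero] at hn
    exact absurd hn (not_lt.2 (by positivity))
  have hnR : (0 : ℝ) < n := by positivity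
  refine ⟨Fin n → Z, averageMetric Z n hn0, inferInstance, fun c => ?_⟩
  have hemb : ∀ (g : Fin n → Z ≃ᵢ Z) {X : Type} [MetricSpace X] (f : X → Z), IsIsomEmb f →
      @IsIsomEmb _ _ _ (averageMetric Z n hn0) fun x i => g i (f x) := fun g X _ f hf =>
    isIsomEmb_pi hn0 fun i x y => ((g i).dist_eq _ _).trans (hf x y)
  have heτ : ∀ τ : M → N, IsIsomEmb τ → IsIsomEmb (e ∘ τ) := fun τ hτ x y => (he _ _).trans (hτ x y)
  let col : (Fin n → Z ≃ᵢ Z) → Fin r := fun g => c fun x i => g i (e (τ₀ x))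
  choose γ hγ using fun τ : E => hext τ₀ τ hτ₀ τ.2
  obtain ⟨i, g, hg⟩ := exists_translate_hammingDist_lt γ hη0 hn col
  refine ⟨fun x i => g i (e x), hemb g e he, i, fun τ hτ => ?_⟩
  obtain ⟨h, hcol, hdist⟩ := hg ⟨τ, hτ⟩
  refine ⟨fun x i => h i (e (τ₀ x)), hemb h (e ∘ τ₀) (heτ τ₀ hτ₀), hcol, fun x => ?_⟩
  change (∑ i, dist (g i (e (τ x))) (h i (e (τ₀ x)))) / (n : ℝ) ≤ ε
  rw [div_le_iff₀ hnR]
  have hmove : ∀ i, g i (e (τ x)) = (g i * γ ⟨τ, hτ⟩) (e (τ₀ x)) := fun i =>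
    (congrArg (g i) (hγ ⟨τ, hτ⟩ x)).symm
  simp only [hmove]
  calc _ ≤ _ := sum_dist_le_hammingDist_mul (fun a : Z ≃ᵢ Z => a (e (τ₀ x))) hC _ h
    _ ≤ η * n * C := by
      gcongr
      convert hdist.le
    _ = ε * n := by
      rw [hη]
      field_simp
end

section
/- For every k, m, r ∈ ℕ there exists n ∈ ℕ such that every r-coloring of FIN_k(n) has a monochromatic set of the form ⟨f_i⟩_{i<m} for some disjointly supported sequence (f_i)_{i<m} in FIN_k(n); moreover n = GR(k+1, km+1, r) suffices, where GR denotes the Dual Ramsey numbers. -/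
/-- Rigid surjections between finite linear orders (here `Fin n → Fin d`). -/
def IsRigidSurjection {α β : Type*} [LinearOrder α] [LinearOrder β] (f : α → β) : Prop :=
  Function.Surjective f ∧
    ∀ s₀ s₁ : β, s₀ < s₁ → ∃ a, f a = s₀ ∧ ∀ b, f b = s₁ → a < b

/-- The Dual Ramsey Theorem holds for parameters `d`, `m`, `r` at `n`. -/
def DRTHolds (d m r n : ℕ) : Prop :=
  ∀ c : (Fin n → Fin d) → Fin r, ∃ γ : Fin n → Fin m, IsRigidSurjection γ ∧
    ∀ σ σ' : Fin m → Fin d, IsRigidSurjection σ → IsRigidSurjection σ' →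
      c (σ ∘ γ) = c (σ' ∘ γ)

/-- The Dual Ramsey numbers: the least `n` such that the Dual Ramsey Theorem holds for
linear orders of sizes `d` and `m` with `r` colors. -/
noncomputable def GR (d m r : ℕ) : ℕ := sInf {n | DRTHolds d m r n}

/-- `f ∈ FIN_k(n)`: `f : Fin n → {0, …, k}` attains the value `k`. -/
def MemFIN (k n : ℕ) (f : Fin n → ℕ) : Prop := (∀ i, f i ≤ k) ∧ ∃ i, f i = k

/-- The tetris operation `T(f)(i) = max (f i − 1) 0`. -/
def tetris {n : ℕ} (f : Fin n → ℕ) : Fin n → ℕ := fun i => f i - 1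

/-- Gowers' theorem for `FIN_k` holds at `n`: every `r`-coloring of `FIN_k(n)` has a
monochromatic combinatorial space `⟨f_j⟩_{j<m}` spanned by a disjointly supported
sequence `(f_j)_{j<m}` in `FIN_k(n)`, i.e. the coloring is constant on all combinations
`∑_{j<m} T^{k − s j}(f j)` with `s ∈ FIN_k(m)`. -/
def GowersProp (k m r n : ℕ) : Prop :=
  ∀ c : (Fin n → ℕ) → Fin r, ∃ f : Fin m → (Fin n → ℕ),
    (∀ j, MemFIN k n (f j)) ∧
    (∀ j j', j ≠ j' → ∀ i, f j i = 0 ∨ f j' i = 0) ∧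
    ∀ s s' : Fin m → ℕ, MemFIN k m s → MemFIN k m s' →
      c (fun i => ∑ j, tetris^[k - s j] (f j) i) =
      c (fun i => ∑ j, tetris^[k - s' j] (f j) i)

/-- Each value `p` is attained by `g`, for the first time after only smaller values. On `ℕ` this
is the rigid surjectivity of `g`. -/
def FirstHits (g : ℕ → ℕ) : Prop := ∀ p, ∃ q, g q = p ∧ ∀ i < q, g i < p

/-- A rigid surjection of `{0, …, n - 1}` onto `{0, …, m - 1}` fixing `0, …, a - 1`, extended to
`ℕ` by a shift. -/
structure RigidMap (a n m : ℕ) (g : ℕ → ℕ) : Prop where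
  hits : FirstHits g
  fix : ∀ i < a, g i = i
  lt : ∀ i < n, g i < m
  tail : ∀ i, g (n + i) = m + i

theorem FirstHits.comp {f g : ℕ → ℕ} (hf : FirstHits f) (hg : FirstHits g) :
    FirstHits (f ∘ g) := by
  intro p
  obtain ⟨q, rfl, hq⟩ := hf p
  obtain ⟨t, rfl, ht⟩ := hg q
  exact ⟨t, rfl, fun i hi => hq _ (ht i hi)⟩

theorem FirstHits.map_zero {g : ℕ → ℕ} (hg : FirstHits g) : g 0 = 0 := by
  obtain ⟨q, h0, hq⟩ := hg 0
  rcases Nat.eq_zero_or_pos q with rfl | h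
  · exact h0
  · exact absurd (hq 0 h) (Nat.not_lt_zero _)

theorem RigidMap.id (a n : ℕ) : RigidMap a n n id :=
  ⟨fun p => ⟨p, rfl, fun _ h => h⟩, fun _ _ => rfl, fun _ h => h, fun _ => rfl⟩

theorem RigidMap.comp {a n m l : ℕ} {f g : ℕ → ℕ} (hf : RigidMap a m l f)
    (hg : RigidMap a n m g) : RigidMap a n l (f ∘ g) where
  hits := hf.hits.comp hg.hits
  fix i hi := by simp [hg.fix i hi, hf.fix i hi]
  lt i hi := hf.lt _ (hg.lt i hi)
  tail i := by simp [hg.tail, hf.tail]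

theorem RigidMap.mono {a b n m : ℕ} {g : ℕ → ℕ} (hg : RigidMap b n m g) (hab : a ≤ b) :
    RigidMap a n m g :=
  ⟨hg.hits, fun i hi => hg.fix i (hi.trans_le hab), hg.lt, hg.tail⟩

theorem RigidMap.le_of_le {a n m : ℕ} {g : ℕ → ℕ} (hg : RigidMap a n m g) {i : ℕ} (hi : n ≤ i) :
    m ≤ g i := by
  obtain ⟨t, rfl⟩ := Nat.exists_eq_add_of_le hi
  simp [hg.tail]

/-- Substitute the letters of `y` for `a, …, a + N - 1` and shift the larger numbers down. -/
def substLetters {a N : ℕ} (y : Fin N → Fin a) (i : ℕ) : ℕ :=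
  if i < a then i else if h : i - a < N then y ⟨i - a, h⟩ else i - N

/-- The part of `f` below `q`, filled up with the value `a`. -/
def cutoff (a q : ℕ) (f : ℕ → ℕ) (i : ℕ) : ℕ := if i < q then f i else a

theorem substLetters_comp_cutoff {a N : ℕ} (y : Fin N → Fin a) (q : ℕ) (f : ℕ → ℕ) :
    substLetters y ∘ cutoff (a + N) q f = cutoff a q (substLetters y ∘ f) := by
  funext i
  by_cases h : i < q
  · simp [cutoff, h]
  · simp [cutoff, h, substLetters]

/-- The rigid map substituting the variable word `l` for the letter `a`. -/
def lineMap {a N : ℕ} (l : Fin N → Option (Fin a)) (i : ℕ) : ℕ :=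
  if i < a then i else
    if h : i - a < N then (l ⟨i - a, h⟩).elim a (fun z => (z : ℕ)) else i + 1 - N

theorem lineMap_of_lt {a N : ℕ} (l : Fin N → Option (Fin a)) {i : ℕ} (hi : i < a) :
    lineMap l i = i := by simp [lineMap, hi]

theorem lineMap_of_le {a N : ℕ} (l : Fin N → Option (Fin a)) {i : ℕ} (hi : a + N ≤ i) :
    lineMap l i = i + 1 - N := by
  simp [lineMap, show ¬ i < a by omega, show ¬ i - a < N by omega]

theorem lineMap_le {a N : ℕ} (l : Fin N → Option (Fin a)) {i : ℕ} (hi : i < a + N) :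
    lineMap l i ≤ a := by
  unfold lineMap
  split_ifs with h1 h2
  · omega
  · cases l ⟨i - a, h2⟩ with
    | none => simp
    | some z => simp
  · omega

theorem rigidMap_lineMap {a N : ℕ} (l : Fin N → Option (Fin a)) (hl : ∃ i, l i = none) (m : ℕ) :
    RigidMap a (a + N + m) (a + 1 + m) (lineMap l) where
  hits p := by
    rcases lt_trichotomy p a with hp | rfl | hp
    · exact ⟨p, lineMap_of_lt l hp, fun i hi => by rwa [lineMap_of_lt l (hi.trans hp)]⟩
    · obtain ⟨i₀, hi₀, hmin⟩ := WellFounded.has_min (wellFounded_lt (α := Fin N)) {i | l i = none} hl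
      refine ⟨p + i₀, ?_, fun i hi => ?_⟩
      · have : l i₀ = none := hi₀
        simp [lineMap, this]
      · unfold lineMap
        split_ifs with h1 h2
        · exact h1
        · have : ⟨i - p, h2⟩ < i₀ := by
            rw [Fin.lt_def]; simp only; omega
          cases hz : l ⟨i - p, h2⟩ with
          | none => exact absurd this (hmin _ hz)
          | some z => simp
        · have := i₀.2
          omega
    · refine ⟨p + N - 1, ?_, fun i hi => ?_⟩
      · rw [lineMap_of_le l (by omega)]; omega
      · by_cases h : i < a + N
        · exact (lineMap_le l h).trans_lt hp
        · rw [lineMap_of_le l (by omega)]; omega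
  fix i hi := lineMap_of_lt l hi
  lt i hi := by
    by_cases h : i < a + N
    · have := lineMap_le l h
      omega
    · rw [lineMap_of_le l (by omega)]; omega
  tail i := by rw [lineMap_of_le l (by omega)]; omega

/-- The Hales–Jewett theorem for words indexed by an initial segment of `ℕ`. -/
theorem exists_mono_variable_word (a : ℕ) (κ : Type) [Finite κ] :
    ∃ N, ∀ C : (Fin N → Fin a) → κ, ∃ l : Fin N → Option (Fin a), (∃ i, l i = none) ∧
      ∀ x x', C (fun i => (l i).getD x) = C (fun i => (l i).getD x') := by
  obtain ⟨ι, _, h⟩ := Combinatorics.Line.exists_mono_in_high_dimension (Fin a) κ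
  let e := Fintype.equivFin ι
  refine ⟨Fintype.card ι, fun C => ?_⟩
  obtain ⟨l, k, hk⟩ := h (fun w => C (w ∘ e.symm))
  obtain ⟨i, hi⟩ := l.proper
  exact ⟨l.idxFun ∘ e.symm, ⟨e i, by simpa using hi⟩,
    fun x x' => (hk x).trans (hk x').symm⟩

/-- Colorings of words of varying lengths can be made to depend on the length only, after passing
to a parameter word. -/
theorem exists_rigidMap_length_homogeneous (m : ℕ) : ∀ (a : ℕ) (_ : 0 < a) (κ : Type) [Finite κ],
    ∃ n, a ≤ n ∧ ∀ χ : (ℕ → ℕ) → κ, ∃ γ, RigidMap a n (a + m) γ ∧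
      ∀ p q, a ≤ p → p ≤ a + m → γ q = p → (∀ i < q, γ i < p) →
        ∀ x x' : ℕ → ℕ, (∀ i < a, x i = i) → (∀ i < p, x i < a) → (∀ i < a, x' i = i) →
          (∀ i < p, x' i < a) → χ (cutoff a q (x ∘ γ)) = χ (cutoff a q (x' ∘ γ)) := by
  induction m with
  | zero =>
    intro a _ κ _
    refine ⟨a, le_rfl, fun χ => ⟨id, RigidMap.id a a, ?_⟩⟩
    intro p q hp hp' hq _ x x' hx _ hx' _
    congr 1
    funext i
    unfold cutoff
    split_ifs with h
    · have : i < a := by simp at hq; omega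
      simp [hx i this, hx' i this]
    · rfl
  | succ m ih =>
    intro a ha κ _
    obtain ⟨N, hN⟩ := exists_mono_variable_word a (Fin (m + 1) → κ)
    obtain ⟨n, hn, H⟩ := ih (a + N) (by omega) ((Fin N → Fin a) → κ)
    refine ⟨n, by omega, fun χ => ?_⟩
    obtain ⟨γ, hγ, hχ⟩ := H (fun f y => χ (substLetters y ∘ f))
    choose Q hQ hQlt using hγ.hits
    let τ₀ : ℕ → ℕ := fun i => if i < a + N then i else 0
    obtain ⟨l, hl, hmono⟩ := hN (fun y t =>
      χ (substLetters y ∘ cutoff (a + N) (Q (a + N + t)) (τ₀ ∘ γ)))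
    refine ⟨lineMap l ∘ γ, ?_, ?_⟩
    · have := (rigidMap_lineMap l hl m).comp (hγ.mono (Nat.le_add_right a N))
      rwa [show a + 1 + m = a + (m + 1) by omega] at this
    intro p q hap hpm hq hqlt
    rcases hap.eq_or_lt with rfl | hap
    · intro x x' hx _ hx' _
      congr 1
      funext i
      unfold cutoff
      split_ifs with h
      · have := hqlt i h
        simp only [Function.comp_apply] at this ⊢
        rw [hx _ this, hx' _ this]
      · rfl
    obtain ⟨t, rfl⟩ : ∃ t, p = a + 1 + t := Nat.exists_eq_add_of_le hap
    have hγq : γ q = a + N + t := by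
      simp only [Function.comp_apply] at hq
      by_cases h : γ q < a + N
      · have := lineMap_le l h
        omega
      · rw [lineMap_of_le l (by omega)] at hq; omega
    have hγlt : ∀ i < q, γ i < a + N + t := by
      intro i hi
      have := hqlt i hi
      simp only [Function.comp_apply] at this
      by_contra h
      rw [lineMap_of_le l (by omega)] at this; omega
    have hqQ : q = Q (a + N + t) := by
      rcases lt_trichotomy q (Q (a + N + t)) with h | h | h
      · have := hQlt _ _ h
        omega
      · exact h
      · have := hγlt _ h
        rw [hQ] at this
        omega
    have key : ∀ x : ℕ → ℕ, (∀ i < a, x i = i) → (∀ i < a + 1 + t, x i < a) → ∃ z : Fin a,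
        χ (cutoff a q (x ∘ lineMap l ∘ γ)) = χ (substLetters (fun i => (l i).getD z) ∘
          cutoff (a + N) (Q (a + N + t)) (τ₀ ∘ γ)) := by
      intro x hx hxlt
      let z : Fin a := ⟨x a, hxlt a (by omega)⟩
      refine ⟨z, ?_⟩
      let τ : ℕ → ℕ := fun i => if i < a + N then i else x (i + 1 - N)
      have e1 : cutoff a q (x ∘ lineMap l ∘ γ) =
          substLetters (fun i => (l i).getD z) ∘ cutoff (a + N) q (τ ∘ γ) := by
        rw [substLetters_comp_cutoff]
        funext i
        unfold cutoff
        split_ifs with h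
        · have hi := hγlt i h
          simp only [Function.comp_apply]
          generalize γ i = j at hi
          by_cases h1 : j < a + N
          · simp only [τ, if_pos h1]
            unfold substLetters lineMap
            by_cases h2 : j < a
            · simp [h2, hx j h2]
            · have h3 : j - a < N := by omega
              simp only [if_neg h2, dif_pos h3]
              cases l ⟨j - a, h3⟩ with
              | none => simp [z]
              | some w => simp [hx w w.2]
          · have h2 := hxlt (j + 1 - N) (by omega)
            simp only [τ, if_neg h1]
            rw [lineMap_of_le l (by omega)]
            simp [substLetters, h2]
        · rfl
      have e2 := hχ (a + N + t) q (by omega) (by omega) hγq hγlt τ τ₀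
        (fun i hi => by simp [τ, hi])
        (fun i hi => by
          simp only [τ]
          split_ifs with h
          · exact h
          · exact (hxlt _ (by omega)).trans_le (by omega))
        (fun i hi => by simp [τ₀, hi])
        (fun i hi => by
          simp only [τ₀]
          split_ifs with h <;> omega)
      rw [e1, ← hqQ]
      exact congrFun e2 _
    intro x x' hx hxlt hx' hxlt'
    obtain ⟨z, hz⟩ := key x hx hxlt
    obtain ⟨z', hz'⟩ := key x' hx' hxlt'
    rw [hz, hz']
    exact congrFun (hmono z z') ⟨t, by omega⟩

/-- The Graham–Rothschild theorem for words with `a` constants and `d` parameters. -/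
def GrahamRothschild (a d : ℕ) : Prop :=
  ∀ (M : ℕ) (_ : a ≤ M) (κ : Type) [Finite κ], ∃ n, a ≤ n ∧ ∀ c : (ℕ → ℕ) → κ,
    ∃ γ, RigidMap a n M γ ∧ ∀ σ σ', RigidMap a M (a + d) σ → RigidMap a M (a + d) σ' →
      c (σ ∘ γ) = c (σ' ∘ γ)

theorem grahamRothschild_zero {a : ℕ} (ha : 0 < a) : GrahamRothschild a 0 := by
  intro M hM κ _
  obtain ⟨m, rfl⟩ := Nat.exists_eq_add_of_le hM
  obtain ⟨n, hn, H⟩ := exists_rigidMap_length_homogeneous m a ha κ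
  refine ⟨n, hn, fun c => ?_⟩
  obtain ⟨γ, hγ, h⟩ := H (fun f => c (fun i => if i < n then f i else a + (i - n)))
  refine ⟨γ, hγ, fun σ σ' hσ hσ' => ?_⟩
  have key : ∀ σ, RigidMap a (a + m) (a + 0) σ →
      (fun i => if i < n then cutoff a n (σ ∘ γ) i else a + (i - n)) = σ ∘ γ := by
    intro σ hσ
    funext i
    split_ifs with hi
    · simp [cutoff, hi]
    · obtain ⟨t, rfl⟩ := Nat.exists_eq_add_of_le (not_lt.1 hi)
      simp [hγ.tail, hσ.tail]
  have := h (a + m) n (by omega) le_rfl (hγ.tail 0) hγ.lt σ σ' hσ.fix hσ.lt hσ'.fix hσ'.lt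
  simpa only [key σ hσ, key σ' hσ'] using this

/-- A rigid map whose first parameter occurs at `a + j` factors through the substitution of the
letters preceding it. -/
theorem RigidMap.exists_factor {a d j M : ℕ} {σ : ℕ → ℕ} (hσ : RigidMap a M (a + (d + 1)) σ)
    (hj : σ (a + j) = a) (hlt : ∀ i < a + j, σ i < a) {y : Fin j → Fin a}
    (hy : ∀ i : Fin j, σ (a + i) = y i) :
    ∃ τ, RigidMap (a + j + 1) M (a + j + 1 + d) τ ∧ σ = substLetters y ∘ τ := by
  have hjM : a + j < M := by
    by_contra h
    have := hσ.le_of_le (not_lt.1 h)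
    omega
  refine ⟨fun i => if i < a + j + 1 then i else if σ i < a then σ i else σ i + j,
    ⟨?_, ?_, ?_, ?_⟩, ?_⟩
  · intro p
    by_cases hp : p < a + j + 1
    · refine ⟨p, by simp [hp], fun i hi => ?_⟩
      simp [hi.trans hp, hi]
    · obtain ⟨q, hq, hqlt⟩ := hσ.hits (p - j)
      have hqj : ¬ q < a + j + 1 := by
        intro h
        rcases (Nat.lt_succ_iff.1 h).eq_or_lt with rfl | h
        · omega
        · have := hlt q h
          omega
      refine ⟨q, ?_, fun i hi => ?_⟩
      · simp only [if_neg hqj]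
        split_ifs <;> omega
      · have := hqlt i hi
        simp only
        split_ifs <;> omega
  · intro i hi
    simp [hi]
  · intro i hi
    have := hσ.lt i hi
    split_ifs <;> omega
  · intro i
    have := hσ.tail i
    split_ifs <;> omega
  · funext i
    simp only [Function.comp_apply]
    split_ifs with h1 h2
    · unfold substLetters
      split_ifs with h3 h4
      · exact hσ.fix i h3
      · rw [← hy]; congr 1; simp only; omega
      · rw [show i = a + j by omega, hj]; omega
    · simp [substLetters, h2]
    · simp [substLetters, show ¬ σ i + j < a by omega, show ¬ σ i + j - a < j by omega]

/-- Colorings can be made to depend only on the letters preceding the first parameter, as long as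
that parameter occurs before `a + j`. -/
theorem exists_rigidMap_end_homogeneous {a d : ℕ} (hd : ∀ b, a < b → GrahamRothschild b d)
    (κ : Type) [Finite κ] (j : ℕ) : ∀ M, a ≤ M → ∃ n, a ≤ n ∧ ∀ c : (ℕ → ℕ) → κ,
      ∃ γ, RigidMap a n M γ ∧ ∀ σ σ', RigidMap a M (a + (d + 1)) σ →
        RigidMap a M (a + (d + 1)) σ' → ∀ p < a + j, (∀ i < p, σ i = σ' i) → (∀ i < p, σ i < a) →
          σ p = a → σ' p = a → c (σ ∘ γ) = c (σ' ∘ γ) := by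
  induction j with
  | zero =>
    intro M hM
    refine ⟨M, hM, fun c => ⟨id, RigidMap.id a M, fun σ σ' hσ _ p hp _ _ h _ => ?_⟩⟩
    rw [hσ.fix p hp] at h
    omega
  | succ j ih =>
    intro M hM
    by_cases hMj : M ≤ a + j
    · obtain ⟨n, hn, H⟩ := ih M hM
      refine ⟨n, hn, fun c => ?_⟩
      obtain ⟨γ, hγ, h⟩ := H c
      refine ⟨γ, hγ, fun σ σ' hσ hσ' p _ h1 h2 h3 h4 => h σ σ' hσ hσ' p ?_ h1 h2 h3 h4⟩
      by_contra hp
      have := hσ.le_of_le (show M ≤ p by omega)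
      omega
    obtain ⟨n', hn', H'⟩ := hd (a + j + 1) (by omega) M (by omega) ((Fin j → Fin a) → κ)
    obtain ⟨n, hn, H⟩ := ih n' (by omega)
    refine ⟨n, hn, fun c => ?_⟩
    obtain ⟨γ, hγ, h⟩ := H c
    obtain ⟨δ, hδ, h'⟩ := H' (fun τ y => c (substLetters y ∘ τ ∘ γ))
    have hδ' : RigidMap a n' M δ := hδ.mono (by omega)
    refine ⟨δ ∘ γ, hδ'.comp hγ, fun σ σ' hσ hσ' p hp heq hlt hσp hσp' => ?_⟩
    rcases (show p ≤ a + j by omega).eq_or_lt with rfl | hp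
    · let y : Fin j → Fin a := fun i => ⟨σ (a + i), hlt _ (by omega)⟩
      obtain ⟨τ, hτ, hστ⟩ := hσ.exists_factor hσp hlt (y := y) (fun _ => rfl)
      obtain ⟨τ', hτ', hστ'⟩ := hσ'.exists_factor hσp' (fun i hi => heq i hi ▸ hlt i hi) (y := y)
        (fun i => (heq _ (by omega)).symm)
      rw [hστ, hστ']
      exact congrFun (h' τ τ' hτ hτ') y
    · have hfix : ∀ i ≤ p, δ i = i := fun i hi => hδ.fix i (by omega)
      refine h (σ ∘ δ) (σ' ∘ δ) (hσ.comp hδ') (hσ'.comp hδ') p hp ?_ ?_ ?_ ?_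
      · intro i hi
        simp [hfix i hi.le, heq i hi]
      · intro i hi
        simp [hfix i hi.le, hlt i hi]
      · simp [hfix p le_rfl, hσp]
      · simp [hfix p le_rfl, hσp']

/-- Colorings can be made to depend only on the position of the first parameter. -/
theorem exists_rigidMap_position_homogeneous {a d : ℕ} (ha : 0 < a)
    (hd : ∀ b, a < b → GrahamRothschild b d) (M : ℕ) (hM : a ≤ M) (κ : Type) [Finite κ] :
    ∃ n, a ≤ n ∧ ∀ c : (ℕ → ℕ) → κ,
      ∃ γ, RigidMap a n M γ ∧ ∀ σ σ', RigidMap a M (a + (d + 1)) σ →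
        RigidMap a M (a + (d + 1)) σ' → ∀ p, (∀ i < p, σ i < a) → (∀ i < p, σ' i < a) →
          σ p = a → σ' p = a → c (σ ∘ γ) = c (σ' ∘ γ) := by
  classical
  obtain ⟨m, rfl⟩ := Nat.exists_eq_add_of_le hM
  obtain ⟨n', hn', H'⟩ := exists_rigidMap_length_homogeneous m a ha κ
  obtain ⟨n, hn, H⟩ := exists_rigidMap_end_homogeneous hd κ n' n' hn'
  refine ⟨n, hn, fun c => ?_⟩
  obtain ⟨γ, hγ, h⟩ := H c
  let S : (ℕ → ℕ) → (ℕ → ℕ) → Prop := fun f σ => RigidMap a n' (a + (d + 1)) σ ∧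
    ∃ q, f = cutoff a q σ ∧ (∀ i < q, σ i < a) ∧ σ q = a
  let χ : (ℕ → ℕ) → κ := fun f => if hf : ∃ σ, S f σ then c (hf.choose ∘ γ) else c id
  have hχ : ∀ q σ, RigidMap a n' (a + (d + 1)) σ → (∀ i < q, σ i < a) → σ q = a →
      χ (cutoff a q σ) = c (σ ∘ γ) := by
    intro q σ hσ hlt hq
    have hex : ∃ σ', S (cutoff a q σ) σ' := ⟨σ, hσ, q, rfl, hlt, hq⟩
    simp only [χ, dif_pos hex]
    obtain ⟨hσ', q', heq, hlt', hq'⟩ := hex.choose_spec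
    generalize hex.choose = σ' at *
    have hqq : q = q' := by
      rcases lt_trichotomy q q' with hlt₁ | h₁ | hlt₁
      · have e := congrFun heq q
        have := hlt' q hlt₁
        simp only [cutoff, lt_irrefl, if_false, hlt₁, if_true] at e
        omega
      · exact h₁
      · have e := congrFun heq q'
        have := hlt q' hlt₁
        simp only [cutoff, lt_irrefl, if_false, hlt₁, if_true] at e
        omega
    subst hqq
    have hagree : ∀ i < q, σ' i = σ i := by
      intro i hi
      have e := congrFun heq i
      simpa [cutoff, hi] using e.symm
    refine h σ' σ hσ' hσ q ?_ hagree hlt' hq' hq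
    by_contra hqn
    have := hσ.le_of_le (show n' ≤ q by omega)
    omega
  obtain ⟨δ, hδ, h'⟩ := H' χ
  refine ⟨δ ∘ γ, hδ.comp hγ, fun σ σ' hσ hσ' p hlt hlt' hp hp' => ?_⟩
  obtain ⟨q, hq, hqlt⟩ := hδ.hits p
  have hap : a ≤ p := by
    by_contra hpa
    have := hσ.fix p (by omega)
    omega
  have hpm : p ≤ a + m := by
    by_contra hpm
    have := hσ.le_of_le (show a + m ≤ p by omega)
    omega
  have e := h' p q hap hpm hq hqlt σ σ' hσ.fix hlt hσ'.fix hlt'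
  rwa [hχ q (σ ∘ δ) (hσ.comp hδ) (fun i hi => hlt _ (hqlt i hi)) (by simp [hq, hp]),
    hχ q (σ' ∘ δ) (hσ'.comp hδ) (fun i hi => hlt' _ (hqlt i hi)) (by simp [hq, hp'])] at e

/-- Every large enough coloring of positions is constant on the positions of the parameters of a
parameter word. -/
theorem exists_rigidMap_mono_positions {a : ℕ} (ha : 0 < a) (m : ℕ) (κ : Type) [Finite κ] :
    ∃ M, a ≤ M ∧ ∀ e : ℕ → κ, ∃ γ, RigidMap a M (a + m) γ ∧
      ∃ k, ∀ p q, a ≤ p → p < a + m → γ q = p → e q = k := by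
  classical
  have := Fintype.ofFinite κ
  refine ⟨a + Fintype.card κ * m, by omega, fun e => ?_⟩
  have : Nonempty κ := ⟨e 0⟩
  obtain ⟨k, -, hk⟩ := Finset.exists_le_card_fiber_of_mul_le_card_of_maps_to
    (s := Finset.Ico a (a + Fintype.card κ * m)) (t := Finset.univ) (f := e) (n := m)
    (fun _ _ => Finset.mem_univ _) Finset.univ_nonempty (by simp)
  obtain ⟨S, hS, hSm⟩ := Finset.exists_subset_card_eq hk
  have hMa : a ≤ a + Fintype.card κ * m := Nat.le_add_right _ _
  generalize a + Fintype.card κ * m = M at *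
  have hSI : ∀ i ∈ S, a ≤ i ∧ i < M ∧ e i = k := by
    intro i hi
    simpa [and_assoc] using hS hi
  let P : ℕ → Prop := fun i => i < a ∨ i ∈ S ∨ M ≤ i
  have hinf : (Set.ofPred P).Infinite :=
    (Set.Ici_infinite M).mono fun i hi => Or.inr (Or.inr hi)
  have hcM : Nat.count P M = a + m := by
    rw [Nat.count_eq_card_filter_range,
      show (Finset.range M).filter P = Finset.range a ∪ S by
        ext i
        have := hSI i
        simp only [Finset.mem_filter, Finset.mem_range, Finset.mem_union, P]
        constructor
        · rintro ⟨h1, h2 | h2 | h2⟩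
          · exact Or.inl h2
          · exact Or.inr h2
          · omega
        · rintro (h | h)
          · exact ⟨by omega, Or.inl h⟩
          · exact ⟨(this h).2.1, Or.inr (Or.inl h)⟩,
      Finset.card_union_of_disjoint, Finset.card_range, hSm]
    rw [Finset.disjoint_left]
    intro i hi hiS
    have := hSI i hiS
    simp at hi
    omega
  have hca : ∀ i ≤ a, Nat.count P i = i := by
    intro i hi
    rw [Nat.count_iff_forall]
    intro j hj
    exact Or.inl (by omega)
  refine ⟨fun i => if P i then Nat.count P i else 0, ⟨?_, ?_, ?_, ?_⟩, k, ?_⟩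
  · intro p
    refine ⟨Nat.nth P p, ?_, fun i hi => ?_⟩
    · simp [Nat.nth_mem_of_infinite hinf p, Nat.count_nth_of_infinite hinf]
    · simp only
      split_ifs with h
      · have := Nat.count_strict_mono h hi
        rwa [Nat.count_nth_of_infinite hinf] at this
      · rcases Nat.eq_zero_or_pos p with rfl | hp
        · have : Nat.nth P 0 = 0 := by
            have := Nat.nth_count (p := P) (n := 0) (Or.inl ha)
            simpa using this
          omega
        · exact hp
  · intro i hi
    simp only [if_pos (show P i from Or.inl hi)]
    exact hca i hi.le
  · intro i hi
    split_ifs with h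
    · rw [← hcM]
      exact Nat.count_strict_mono h hi
    · omega
  · intro i
    simp only [if_pos (show P (M + i) from Or.inr (Or.inr (by omega)))]
    rw [Nat.count_add, hcM, Nat.add_left_cancel_iff, Nat.count_iff_forall]
    intro j _
    exact Or.inr (Or.inr (by omega))
  · intro p q hap hpm hq
    simp only at hq
    split_ifs at hq with h
    · rcases h with h | h | h
      · have := hca q h.le
        omega
      · exact (hSI q h).2.2
      · have := Nat.count_monotone P h
        omega
    · omega

theorem grahamRothschild_succ {a d : ℕ} (ha : 0 < a) (hd : ∀ b, a < b → GrahamRothschild b d) :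
    GrahamRothschild a (d + 1) := by
  classical
  intro M hM κ _
  obtain ⟨m, rfl⟩ := Nat.exists_eq_add_of_le hM
  obtain ⟨n', hn', H'⟩ := exists_rigidMap_mono_positions ha m κ
  obtain ⟨n, hn, H⟩ := exists_rigidMap_position_homogeneous ha hd n' hn' κ
  refine ⟨n, hn, fun c => ?_⟩
  obtain ⟨γ, hγ, h⟩ := H c
  let S : ℕ → (ℕ → ℕ) → Prop := fun q σ =>
    RigidMap a n' (a + (d + 1)) σ ∧ (∀ i < q, σ i < a) ∧ σ q = a
  obtain ⟨δ, hδ, k, h'⟩ := H' fun q => if hq : ∃ σ, S q σ then c (hq.choose ∘ γ) else c id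
  have key : ∀ σ, RigidMap a (a + m) (a + (d + 1)) σ → c (σ ∘ δ ∘ γ) = k := by
    intro σ hσ
    obtain ⟨p, hp, hplt⟩ := hσ.hits a
    have hap : a ≤ p := by
      by_contra hpa
      have := hσ.fix p (by omega)
      omega
    have hpm : p < a + m := by
      by_contra hpm
      have := hσ.le_of_le (not_lt.1 hpm)
      omega
    obtain ⟨q, hq, hqlt⟩ := hδ.hits p
    have hS : S q (σ ∘ δ) := ⟨hσ.comp hδ, fun i hi => hplt _ (hqlt i hi), by simp [hq, hp]⟩
    have hex : ∃ σ', S q σ' := ⟨_, hS⟩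
    rw [← h' p q hap hpm hq, dif_pos hex]
    exact h (σ ∘ δ) hex.choose hS.1 hex.choose_spec.1 q hS.2.1 hex.choose_spec.2.1 hS.2.2
      hex.choose_spec.2.2
  exact ⟨δ ∘ γ, hδ.comp hγ, fun σ σ' hσ hσ' => (key σ hσ).trans (key σ' hσ').symm⟩

theorem grahamRothschild (d : ℕ) : ∀ a, 0 < a → GrahamRothschild a d := by
  induction d with
  | zero => exact fun a ha => grahamRothschild_zero ha
  | succ d ih => exact fun a ha => grahamRothschild_succ ha fun b hb => ih b (ha.trans hb)

theorem IsRigidSurjection.rigidMap {M b : ℕ} {σ : Fin M → Fin b} (hσ : IsRigidSurjection σ) :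
    RigidMap 1 M b (fun i => if h : i < M then σ ⟨i, h⟩ else b + (i - M)) := by
  have hits : FirstHits (fun i => if h : i < M then (σ ⟨i, h⟩ : ℕ) else b + (i - M)) := by
    intro p
    by_cases hp : p < b
    · obtain ⟨q, hq, hmin⟩ := WellFounded.has_min (wellFounded_lt (α := Fin M))
        {i | σ i = ⟨p, hp⟩} (hσ.1 _)
      have hq' : σ q = ⟨p, hp⟩ := hq
      refine ⟨q, by simp [hq'], fun i hi => ?_⟩
      have hiM : i < M := hi.trans q.2
      simp only [dif_pos hiM]
      by_contra hle
      rcases (not_lt.1 hle).eq_or_lt with he | hl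
      · exact hmin ⟨i, hiM⟩ (Fin.ext he.symm) hi
      · obtain ⟨t, ht, htlt⟩ := hσ.2 ⟨p, hp⟩ (σ ⟨i, hiM⟩) hl
        exact hmin t ht ((htlt _ rfl).trans hi)
    · refine ⟨M + (p - b), by simp; omega, fun i hi => ?_⟩
      simp only
      split_ifs with h
      · exact (Fin.is_lt _).trans_le (not_lt.1 hp)
      · omega
  refine ⟨hits, fun i hi => ?_, fun i hi => ?_, fun i => ?_⟩
  · obtain rfl : i = 0 := by omega
    exact hits.map_zero
  · simp [hi]
  · simp

theorem RigidMap.isRigidSurjection {a n m : ℕ} {g : ℕ → ℕ} (hg : RigidMap a n m g) :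
    IsRigidSurjection (fun i : Fin n => (⟨g i, hg.lt i i.2⟩ : Fin m)) := by
  have key : ∀ p : Fin m, ∃ q : Fin n, g q = p ∧ ∀ i < (q : ℕ), g i < p := by
    intro p
    obtain ⟨q, hq, hlt⟩ := hg.hits p
    refine ⟨⟨q, ?_⟩, hq, hlt⟩
    by_contra h
    have := hg.le_of_le (not_lt.1 h)
    omega
  refine ⟨fun p => ?_, fun s t hst => ?_⟩
  · obtain ⟨q, hq, -⟩ := key p
    exact ⟨q, Fin.ext hq⟩
  · obtain ⟨q, hq, hlt⟩ := key s
    refine ⟨q, Fin.ext hq, fun b hb => ?_⟩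
    have hb' : g b = t := congrArg Fin.val hb
    have hst' : (s : ℕ) < t := hst
    rw [Fin.lt_def]
    rcases lt_trichotomy (q : ℕ) b with h | h | h
    · exact h
    · rw [← h] at hb'
      omega
    · have := hlt b h
      omega

/-- The Dual Ramsey Theorem. -/
theorem exists_drtHolds (k M r : ℕ) : ∃ n, DRTHolds (k + 1) (M + 1) r n := by
  obtain ⟨n, -, H⟩ := grahamRothschild k 1 one_pos (M + 1) (by omega) (Fin r)
  refine ⟨n, fun c => ?_⟩
  obtain ⟨γ, hγ, h⟩ := H fun f => c fun i => Fin.ofNat (k + 1) (f i)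
  refine ⟨fun i => ⟨γ i, hγ.lt i i.2⟩, hγ.isRigidSurjection, fun σ σ' hσ hσ' => ?_⟩
  have key : ∀ σ : Fin (M + 1) → Fin (k + 1), (fun i : Fin n => Fin.ofNat (k + 1)
      (((fun i : ℕ => if h : i < M + 1 then (σ ⟨i, h⟩ : ℕ) else (k + 1) + (i - (M + 1))) ∘ γ) i)) =
        σ ∘ fun i : Fin n => ⟨γ i, hγ.lt i i.2⟩ := by
    intro σ
    funext i
    have := hγ.lt i i.2
    ext
    simp [Nat.le_of_lt_succ this]
  rw [Nat.add_comm 1 k] at h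
  have e := h _ _ hσ.rigidMap hσ'.rigidMap
  simpa only [key] using e

theorem iterate_tetris {n : ℕ} (t : ℕ) (f : Fin n → ℕ) (i : Fin n) : tetris^[t] f i = f i - t := by
  induction t generalizing f with
  | zero => rfl
  | succ t ih =>
    rw [Function.iterate_succ_apply, ih, tetris]
    omega

theorem isRigidSurjection_of_exists_lt {n b : ℕ} {σ : Fin n → Fin (b + 1)}
    (htop : ∃ i, σ i = Fin.last b) (h : ∀ i, ∀ v < σ i, ∃ j < i, σ j = v) :
    IsRigidSurjection σ := by
  have hsurj : Function.Surjective σ := by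
    intro v
    obtain ⟨i, hi⟩ := htop
    rcases (Fin.le_last v).eq_or_lt with rfl | hv
    · exact ⟨i, hi⟩
    · obtain ⟨j, -, hj⟩ := h i v (hi ▸ hv)
      exact ⟨j, hj⟩
  refine ⟨hsurj, fun s t hst => ?_⟩
  obtain ⟨q, hq, hmin⟩ := WellFounded.has_min (wellFounded_lt (α := Fin n)) {i | σ i = s} (hsurj s)
  refine ⟨q, hq, fun i hi => ?_⟩
  obtain ⟨j, hji, hj⟩ := h i s (hi ▸ hst)
  exact (not_lt.1 (hmin j hj)).trans_lt hji

/-- The position of `t` in the block `{j * k + 1, …, j * k + k}`, and `0` outside of it. -/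
def blockPos (k j t : ℕ) : ℕ := if j * k < t ∧ t ≤ j * k + k then t - j * k else 0

theorem blockPos_le (k j t : ℕ) : blockPos k j t ≤ k := by
  unfold blockPos
  split_ifs <;> omega

theorem blockPos_self {k j i : ℕ} (h : i ≤ k) : blockPos k j (j * k + i) = i := by
  unfold blockPos
  split_ifs <;> omega

theorem blockPos_eq_zero_or {k j j' : ℕ} (h : j ≠ j') (t : ℕ) :
    blockPos k j t = 0 ∨ blockPos k j' t = 0 := by
  wlog hlt : j < j' generalizing j j'
  · exact (this h.symm (by omega)).symm
  have : (j + 1) * k ≤ j' * k := Nat.mul_le_mul_right k hlt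
  rw [Nat.succ_mul] at this
  unfold blockPos
  split_ifs <;> omega

theorem sum_blockPos_sub {k m i : ℕ} (hi : 0 < i) (hik : i ≤ k) (s : Fin m → ℕ) (j : Fin m) :
    ∑ j' : Fin m, (blockPos k j' (j * k + i) - (k - s j')) = i - (k - s j) := by
  rw [Finset.sum_eq_single j, blockPos_self hik]
  · intro j' _ hj'
    rcases blockPos_eq_zero_or (k := k) (Fin.val_ne_of_ne hj') (j * k + i) with h | h
    · simp [h]
    · rw [blockPos_self hik] at h
      omega
  · simp

theorem exists_eq_mul_add {k m t : ℕ} (ht : 0 < t) (htm : t ≤ k * m) :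
    ∃ (j : Fin m) (i : ℕ), 0 < i ∧ i ≤ k ∧ t = j * k + i := by
  have hk : 0 < k := Nat.pos_of_ne_zero fun h => by simp [h] at htm; omega
  refine ⟨⟨(t - 1) / k, Nat.div_lt_of_lt_mul (by omega)⟩, (t - 1) % k + 1, by omega,
    Nat.mod_lt _ hk, ?_⟩
  have := Nat.div_add_mod' (t - 1) k
  simp only
  omega

theorem sum_blockPos_zero {k m : ℕ} (s : Fin m → ℕ) :
    ∑ j : Fin m, (blockPos k j 0 - (k - s j)) = 0 := by
  simp [blockPos]

theorem sum_blockPos_le {k m t : ℕ} (htm : t ≤ k * m) (s : Fin m → ℕ) :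
    ∑ j : Fin m, (blockPos k j t - (k - s j)) ≤ k := by
  rcases Nat.eq_zero_or_pos t with rfl | ht
  · simp [sum_blockPos_zero]
  · obtain ⟨j, i, hi, hik, rfl⟩ := exists_eq_mul_add ht htm
    rw [sum_blockPos_sub hi hik]
    omega

theorem mul_add_le_of_fin {k m i : ℕ} (hik : i ≤ k) (j : Fin m) : j * k + i ≤ k * m := by
  have := Nat.mul_le_mul_right k (Nat.succ_le_of_lt j.2)
  rw [Nat.succ_mul, Nat.mul_comm m] at this
  omega

theorem isRigidSurjection_sum_blockPos {k m : ℕ} (hk : 0 < k) {s : Fin m → ℕ}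
    (hs : MemFIN k m s) :
    IsRigidSurjection fun t : Fin (k * m + 1) => (⟨∑ j : Fin m, (blockPos k j t - (k - s j)),
      Nat.lt_succ_of_le (sum_blockPos_le (Nat.le_of_lt_succ t.2) s)⟩ : Fin (k + 1)) := by
  refine isRigidSurjection_of_exists_lt ?_ fun t v hv => ?_
  · obtain ⟨j, hj⟩ := hs.2
    refine ⟨⟨j * k + k, Nat.lt_succ_of_le (mul_add_le_of_fin le_rfl j)⟩, Fin.ext ?_⟩
    simp [sum_blockPos_sub hk le_rfl, hj]
  · obtain ⟨t, ht⟩ := t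
    obtain ⟨v, hvk⟩ := v
    simp only [Fin.mk_lt_mk] at hv
    have ht0 : 0 < t := by
      by_contra h
      obtain rfl : t = 0 := by omega
      simp [sum_blockPos_zero] at hv
    rcases Nat.eq_zero_or_pos v with rfl | hv0
    · exact ⟨⟨0, by omega⟩, ht0, Fin.ext (sum_blockPos_zero s)⟩
    obtain ⟨j, i, hi, hik, rfl⟩ := exists_eq_mul_add ht0 (Nat.le_of_lt_succ ht)
    rw [sum_blockPos_sub hi hik] at hv
    refine ⟨⟨j * k + (v + (k - s j)), by omega⟩, ?_, Fin.ext ?_⟩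
    · rw [Fin.lt_def]
      simp only
      omega
    · simp only
      rw [sum_blockPos_sub (by omega) (by omega)]
      omega

/-- Gowers' theorem follows from the Dual Ramsey Theorem. -/
theorem GowersProp.of_drtHolds {k m r n : ℕ} (hk : 0 < k) (h : DRTHolds (k + 1) (k * m + 1) r n) :
    GowersProp k m r n := by
  intro c
  obtain ⟨γ, hγ, hc⟩ := h fun σ => c fun i => σ i
  refine ⟨fun j i => blockPos k j (γ i), fun j => ⟨fun i => blockPos_le _ _ _, ?_⟩,
    fun j j' hj i => blockPos_eq_zero_or (Fin.val_ne_of_ne hj) _, fun s s' hs hs' => ?_⟩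
  · obtain ⟨i, hi⟩ := hγ.1 ⟨j * k + k, Nat.lt_succ_of_le (mul_add_le_of_fin le_rfl j)⟩
    exact ⟨i, by simp only [hi]; exact blockPos_self le_rfl⟩
  · simp only [iterate_tetris]
    exact hc _ _ (isRigidSurjection_sum_blockPos hk hs) (isRigidSurjection_sum_blockPos hk hs')

/-- Gowers' theorem on `FIN_k`: for every `k, m, r` there exists `n` such that every
`r`-coloring of `FIN_k(n)` has a monochromatic combinatorial subspace `⟨f_j⟩_{j<m}`;
moreover `n = GR(k+1, km+1, r)` suffices. -/
theorem gowers_FINk (k m r : ℕ) (hk : 0 < k) (hm : 0 < m) :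
    (∃ n : ℕ, GowersProp k m r n) ∧ GowersProp k m r (GR (k + 1) (k * m + 1) r) := by
  obtain ⟨n, hn⟩ := exists_drtHolds k (k * m) r
  exact ⟨⟨n, .of_drtHolds hk hn⟩,
    .of_drtHolds hk (Nat.sInf_mem (s := {n | DRTHolds _ _ _ n}) ⟨n, hn⟩)⟩
end
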